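/- arXiv:math/0305057 — 6 statements merged into one kernel-verified Lean document; each statement's English description precedes it below -/
import Mathlib

section
/- Let g be a real Lie algebra of dimension 2k with 2k ≥ 12, equipped with a grading g = g_1 ⊕ g_2 ⊕ … ⊕ g_{2k} (meaning [g_α, g_β] ⊆ g_{α+β}, where g_γ = 0 for γ > 2k) such that dim g_α = 1 for every 1 ≤ α ≤ 2k and [g_1, g_α] = g_{α+1} for every 2 ≤ α ≤ 2k−1. If g admits a symplectic structure, then g is isomorphic as a Lie algebra either to m_0(2k) or to V_{2k}. -/
namespace Paper

open Module Submodule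

variable (K : Type*) [Field K] {g : Type*} [LieRing g] [LieAlgebra K g]

/-- `E : ℕ → g` enumerates a basis `e_1, …, e_n` of the Lie algebra `V_n`
(with `E m = 0` for `m = 0` or `m > n`), i.e. `⁅e_i, e_j⁆ = (j - i) • e_{i+j}`
for `i + j ≤ n` and `⁅e_i, e_j⁆ = 0` for `i + j > n` (`1 ≤ i < j ≤ n`). -/
def IsVnBasis (n : ℕ) (E : ℕ → g) : Prop :=
  (∃ b : Basis (Fin n) K g, ∀ i : Fin n, E ((i : ℕ) + 1) = b i) ∧
  (∀ m : ℕ, m = 0 ∨ n < m → E m = 0) ∧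
  (∀ i j : ℕ, 1 ≤ i → i < j → j ≤ n →
    ⁅E i, E j⁆ = ((j : K) - (i : K)) • E (i + j))

/-- `E : ℕ → g` enumerates a basis `e_1, …, e_n` of the Lie algebra `m_0(n)`
(with `E m = 0` for `m = 0` or `m > n`): the only nonzero brackets among the basis
vectors are `⁅e_1, e_i⁆ = e_{i+1}` for `2 ≤ i ≤ n - 1`. -/
def IsM0Basis (n : ℕ) (E : ℕ → g) : Prop :=
  (∃ b : Basis (Fin n) K g, ∀ i : Fin n, E ((i : ℕ) + 1) = b i) ∧
  (∀ m : ℕ, m = 0 ∨ n < m → E m = 0) ∧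
  (∀ i : ℕ, 2 ≤ i → i ≤ n - 1 → ⁅E 1, E i⁆ = E (i + 1)) ∧
  ⁅E 1, E n⁆ = 0 ∧
  (∀ i j : ℕ, 2 ≤ i → i < j → j ≤ n → ⁅E i, E j⁆ = 0)

/-- A symplectic structure on a Lie algebra: a non-degenerate alternating bilinear
form which is closed. -/
def IsSymplecticForm {K : Type*} [Field K] {g : Type*} [LieRing g] [LieAlgebra K g]
    (ω : g →ₗ[K] g →ₗ[K] K) : Prop :=
  (∀ x : g, ω x x = 0) ∧
  (∀ x : g, (∀ y : g, ω x y = 0) → x = 0) ∧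
  (∀ x y z : g, ω ⁅x, y⁆ z + ω ⁅y, z⁆ x + ω ⁅z, x⁆ y = 0)


theorem alt_lem (f Φ : ℕ → ℝ) (b : ℕ)
    (h : ∀ i, 2 ≤ i → i < b → f (i+1) + f i = (-1)^i * (Φ i - Φ (i+1)))
    (h2 : f 2 = Φ 2) : ∀ i, 2 ≤ i → i ≤ b → f i = (-1)^i * Φ i := by
  intro i hi
  induction i, hi using Nat.le_induction with
  | base => intro _; simp [h2]
  | succ i hi ih =>
    intro hb
    have h1 := h i hi (by omega)
    have h3 := ih (by omega)
    rw [h3] at h1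
    rw [pow_succ]
    linarith

structure Sys (N : ℕ) (c : ℕ → ℕ → ℝ) : Prop where
  anti : ∀ i j, 2 ≤ i → 2 ≤ j → i + j ≤ N → c i j = - c j i
  rc : ∀ i j, 2 ≤ i → 2 ≤ j → i + j + 1 ≤ N → c (i+1) j + c i (j+1) = c i j
  jac : ∀ i j l, 2 ≤ i → 2 ≤ j → 2 ≤ l → i + j + l ≤ N →
    c i j * c (i+j) l + c j l * c (j+l) i + c l i * c (l+i) j = 0

theorem uniq (N : ℕ) (c c' : ℕ → ℕ → ℝ) (hc : Sys N c)
    (anti : ∀ i j, 2 ≤ i → 2 ≤ j → i + j ≤ N → c' i j = - c' j i)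
    (rc : ∀ i j, 2 ≤ i → 2 ≤ j → i + j + 1 ≤ N → c' (i+1) j + c' i (j+1) = c' i j)
    (jac : ∀ l, 4 ≤ l → 5 + l ≤ N →
      c' 2 3 * c' 5 l + c' 3 l * c' (3+l) 2 + c' l 2 * c' (l+2) 3 = 0)
    (co : ∀ l, 4 ≤ l → 5 + l ≤ N → c' 2 3 + c' 3 l + c' 2 l ≠ 0)
    (h23 : c 2 3 = c' 2 3) (h34 : c 3 4 = c' 3 4) :
    ∀ S i j, 2 ≤ i → 2 ≤ j → i + j = S → S ≤ N → c i j = c' i j := by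
  intro S
  induction S using Nat.strong_induction_on with
  | _ S ih =>
  intro i j hi hj hS hN
  have key := alt_lem (fun i => c i (S-i) - c' i (S-i)) (fun _ => c 2 (S-2) - c' 2 (S-2)) (S-2) (by
    intro i hi hb
    obtain ⟨q, rfl⟩ : ∃ q, S = i + q + 1 := ⟨S - i - 1, by omega⟩
    have e1 : i + q + 1 - (i+1) = q := by omega
    have e2 : i + q + 1 - i = q + 1 := by omega
    simp only [e1, e2]
    have a1 := hc.rc i q hi (by omega) (by omega)
    have a2 := rc i q hi (by omega) (by omega)
    have a3 := ih (i+q) (by omega) i q hi (by omega) rfl (by omega)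
    linarith) rfl
  suffices h : c 2 (S-2) - c' 2 (S-2) = 0 by
    have := key i hi (by omega)
    simp only [h] at this
    have e : S - i = j := by omega
    rw [e] at this
    linarith
  rcases Nat.even_or_odd' S with ⟨m, hm | hm⟩
  · have := key m (by omega) (by omega)
    have e : S - m = m := by omega
    simp only [e] at this
    have a1 := hc.anti m m (by omega) (by omega) (by omega)
    have a2 := anti m m (by omega) (by omega) (by omega)
    have a3 : c m m - c' m m = 0 := by linarith
    rw [a3] at this
    rcases mul_eq_zero.1 this.symm with h | h
    · simp at h
    · exact h
  · by_cases h5 : S = 5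
    · subst h5; simp [h23]
    by_cases h7 : S = 7
    · subst h7
      have := key 3 (by omega) (by omega)
      norm_num [h34] at this ⊢
      linarith
    obtain ⟨l, rfl⟩ : ∃ l, S = 5 + l := ⟨S - 5, by omega⟩
    have j1 := hc.jac 2 3 l (by omega) (by omega) (by omega) (by omega)
    have j2 := jac l (by omega) (by omega)
    have k3 := key 3 (by omega) (by omega)
    have k5 := key 5 (by omega) (by omega)
    have e2 : 5 + l - 2 = 3 + l := by omega
    have e3 : 5 + l - 3 = l + 2 := by omega
    have e5 : 5 + l - 5 = l := by omega
    simp only [e2, e3, e5] at k3 k5 ⊢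
    have b1 := ih (3+l) (by omega) 3 l (by omega) (by omega) rfl (by omega)
    have b2 := ih (l+2) (by omega) l 2 (by omega) (by omega) rfl (by omega)
    have b3 := hc.anti (3+l) 2 (by omega) (by omega) (by omega)
    have b4 := anti (3+l) 2 (by omega) (by omega) (by omega)
    have b5 := hc.anti (l+2) 3 (by omega) (by omega) (by omega)
    have b6 := anti (l+2) 3 (by omega) (by omega) (by omega)
    have b7 := anti l 2 (by omega) (by omega) (by omega)
    norm_num at j1
    rw [h23, b1, b2, b3, b5, b7] at j1
    rw [b4, b6, b7] at j2
    have hco := co l (by omega) (by omega)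
    have : (c' 2 3 + c' 3 l + c' 2 l) * (c 2 (3+l) - c' 2 (3+l)) = 0 := by
      norm_num at k3 k5
      have k3' : c 3 (l+2) = c' 3 (l+2) - (c 2 (3+l) - c' 2 (3+l)) := by linarith
      have k5' : c 5 l = c' 5 l - (c 2 (3+l) - c' 2 (3+l)) := by linarith
      rw [k3', k5'] at j1
      linear_combination j2 - j1
    exact (mul_eq_zero.1 this).resolve_left hco

/-- lowest nonzero level at least nine -/
theorem high (N L : ℕ) (c : ℕ → ℕ → ℝ) (hc : Sys N c) (hL : 9 ≤ L) (hodd : Odd L)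
    (hz : ∀ i j, 2 ≤ i → 2 ≤ j → i + j < L → c i j = 0)
    (hne : c 2 (L-2) ≠ 0) (hN : L + 2 = N ∨ L + 4 ≤ N)
    (hnd : c 2 (N-2) ≠ 0) : False := by
  obtain ⟨q, rfl⟩ : ∃ q, L = q + 9 := ⟨L - 9, by omega⟩
  set τ := c 2 (q+7) with hτ
  have hne : τ ≠ 0 := hne
  have f0 := alt_lem (fun i => c i (q + 9 - i)) (fun _ => τ) (q+7) (by
    intro i hi hb
    obtain ⟨p, hp⟩ : ∃ p, q + 9 = i + p + 1 := ⟨q + 9 - i - 1, by omega⟩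
    have e1 : q + 9 - (i+1) = p := by omega
    have e2 : q + 9 - i = p + 1 := by omega
    simp only [e1, e2]
    rw [hc.rc i p hi (by omega) (by omega), hz i p hi (by omega) (by omega)]
    ring) rfl
  have z1 : c (q+9) 2 = 0 := by
    have := hc.jac 3 (q+6) 2 (by omega) (by omega) (by omega) (by omega)
    rw [hz (q+6) 2 (by omega) (by omega) (by omega), hz 2 3 (by omega) (by omega) (by omega)] at this
    have h3 := f0 3 (by omega) (by omega)
    have e : q + 9 - 3 = q + 6 := by omega
    have e' : 3 + (q + 6) = q + 9 := by omega
    simp only [e] at h3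
    rw [h3, e'] at this
    simpa [hne] using this
  have z1' : c 2 (q+9) = 0 := by
    rw [hc.anti _ _ (by omega) (by omega) (by omega), z1, neg_zero]
  rcases hN with hN | hN
  · subst hN; exact hnd z1'
  have z2 : c (q+9) 3 = 0 := by
    have := hc.jac 4 (q+5) 3 (by omega) (by omega) (by omega) (by omega)
    rw [hz (q+5) 3 (by omega) (by omega) (by omega), hz 3 4 (by omega) (by omega) (by omega)] at this
    have h3 := f0 4 (by omega) (by omega)
    have e : q + 9 - 4 = q + 5 := by omega
    have e' : 4 + (q + 5) = q + 9 := by omega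
    simp only [e] at h3
    rw [h3, e'] at this
    simpa [hne] using this
  have z3 : c 2 (q+10) = 0 := by
    have h1 := hc.rc 2 (q+9) (by omega) (by omega) (by omega)
    have h2 := hc.anti 3 (q+9) (by omega) (by omega) (by omega)
    norm_num at h1
    linarith
  have step : ∀ (s : ℕ) (F Φ : ℕ → ℝ), s + 1 ≤ N → 
      (∀ i, 2 ≤ i → i ≤ s - 2 → c i (s - i) = (-1)^i * F i) →
      (∀ i, F i = Φ i - Φ (i+1)) → c 2 (s + 1 - 2) = Φ 2 → 
      ∀ i, 2 ≤ i → i ≤ s + 1 - 2 → c i (s + 1 - i) = (-1)^i * Φ i := by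
    intro s F Φ hs hF hΦ h2
    apply alt_lem (fun i => c i (s + 1 - i)) Φ _ _ h2
    intro i hi hb
    have e1 : s + 1 - (i+1) = s - i := by omega
    have e2 : s + 1 - i = (s - i) + 1 := by omega
    simp only [e1, e2]
    rw [hc.rc i (s - i) hi (by omega) (by omega), hF i hi (by omega), hΦ]
  obtain ⟨r, hr⟩ := hodd
  have hev : Even (q + 8) := ⟨r, by omega⟩
  have f1 := step (q+9) (fun _ => τ) (fun i => c 2 (q+8) + 2 * τ - i * τ) (by omega) f0
    (by intro i; push_cast; ring) (by push_cast; norm_num)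
  have hA : 2 * c 2 (q+8) = (q + 6 : ℝ) * τ := by
    have h1 := f1 (q+8) (by omega) (by omega)
    have e : q + 9 + 1 - (q + 8) = 2 := by omega
    rw [e, hev.neg_one_pow, hc.anti _ _ (by omega) (by omega) (by omega)] at h1
    push_cast at h1
    linarith
  have f2 := step (q+10) _ (fun i => τ / 2 * ((i:ℝ) - 2) * ((i:ℝ) - (q + 9))) (by omega) f1
    (by intro i; push_cast; linear_combination (1/2) * hA)
    (by push_cast
        norm_num
        exact z1')
  have f3 := step (q+11) _ (fun i => - (τ / 12 * ((i:ℝ) - 2) * ((i:ℝ) - 3) * (2 * i - 3 * q - 26))) (by omega) f2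
    (by intro i; push_cast; ring)
    (by push_cast
        norm_num
        exact z3)
  have h1 := f3 (q+10) (by omega) (by omega)
  have hev : Even (q + 10) := ⟨r+1, by omega⟩
  have e : q + 11 + 1 - (q + 10) = 2 := by omega
  rw [e, hev.neg_one_pow, hc.anti _ _ (by omega) (by omega) (by omega), z3] at h1
  push_cast at h1
  have hq : (0:ℝ) ≤ q := q.cast_nonneg
  have : τ * ((q + 8) * (q + 7) * (q + 6)) = 0 := by linear_combination -12 * h1
  have h2 : ((q:ℝ) + 8) * (q + 7) * (q + 6) ≠ 0 := by positivity
  exact (mul_ne_zero hne h2) this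

/-- low dimensional computation -/
theorem low (N : ℕ) (c : ℕ → ℕ → ℝ) (hc : Sys N c) (hN : 12 ≤ N) :
    (c 2 3 = 0 → c 3 4 = 0) ∧ (c 2 3 ≠ 0 → c 3 4 = 0 ∨ c 3 4 = c 2 3 / 10) := by
  have R : ∀ i j, 2 ≤ i → 2 ≤ j → i + j + 1 ≤ 12 → c i (j+1) = c i j - c (i+1) j := by
    intro i j hi hj h
    have := hc.rc i j hi hj (by omega)
    linarith
  have D : ∀ i, 2 ≤ i → i + i ≤ 12 → c i i = 0 := by
    intro i hi h
    have := hc.anti i i hi hi (by omega)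
    linarith
  have A : ∀ i j, 2 ≤ i → 2 ≤ j → i + j ≤ 12 → c i j = - c j i :=
    fun i j hi hj h => hc.anti i j hi hj (by omega)
  have J := fun i j l hi hj hl h => hc.jac i j l hi hj hl (le_trans h hN)
  have c24 : c 2 4 = c 2 3 := by rw [R 2 3 (by omega) (by omega) (by omega), D 3 (by omega) (by omega)]; ring
  have c35 : c 3 5 = c 3 4 := by rw [R 3 4 (by omega) (by omega) (by omega), D 4 (by omega) (by omega)]; ring
  have c46 : c 4 6 = c 4 5 := by rw [R 4 5 (by omega) (by omega) (by omega), D 5 (by omega) (by omega)]; ring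
  have c57 : c 5 7 = c 5 6 := by rw [R 5 6 (by omega) (by omega) (by omega), D 6 (by omega) (by omega)]; ring
  have c25 : c 2 5 = c 2 3 - c 3 4 := by rw [R 2 4 (by omega) (by omega) (by omega), c24]
  have c36 : c 3 6 = c 3 4 - c 4 5 := by rw [R 3 5 (by omega) (by omega) (by omega), c35]
  have c47 : c 4 7 = c 4 5 - c 5 6 := by rw [R 4 6 (by omega) (by omega) (by omega), c46]
  have c26 : c 2 6 = c 2 3 - 2 * c 3 4 := by rw [R 2 5 (by omega) (by omega) (by omega), c25, c35]; ring
  have c37 : c 3 7 = c 3 4 - 2 * c 4 5 := by rw [R 3 6 (by omega) (by omega) (by omega), c36, c46]; ring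
  have c48 : c 4 8 = c 4 5 - 2 * c 5 6 := by rw [R 4 7 (by omega) (by omega) (by omega), c47, c57]; ring
  have c27 : c 2 7 = c 2 3 - 3 * c 3 4 + c 4 5 := by rw [R 2 6 (by omega) (by omega) (by omega), c26, c36]; ring
  have c38 : c 3 8 = c 3 4 - 3 * c 4 5 + c 5 6 := by rw [R 3 7 (by omega) (by omega) (by omega), c37, c47]; ring
  have c28 : c 2 8 = c 2 3 - 4 * c 3 4 + 3 * c 4 5 := by rw [R 2 7 (by omega) (by omega) (by omega), c27, c37]; ring
  have c39 : c 3 9 = c 3 4 - 4 * c 4 5 + 3 * c 5 6 := by rw [R 3 8 (by omega) (by omega) (by omega), c38, c48]; ring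
  have c29 : c 2 9 = c 2 3 - 5 * c 3 4 + 6 * c 4 5 - c 5 6 := by rw [R 2 8 (by omega) (by omega) (by omega), c28, c38]; ring
  have j1 := J 2 3 4 (by omega) (by omega) (by omega) (by omega)
  have j2 := J 2 4 5 (by omega) (by omega) (by omega) (by omega)
  have j3 := J 3 4 5 (by omega) (by omega) (by omega) (by omega)
  norm_num at j1 j2 j3
  rw [A 5 4 (by omega) (by omega) (by omega), A 7 2 (by omega) (by omega) (by omega), A 4 2 (by omega) (by omega) (by omega), A 6 3 (by omega) (by omega) (by omega), c27, c24, c36] at j1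
  rw [A 6 5 (by omega) (by omega) (by omega), A 9 2 (by omega) (by omega) (by omega), A 5 2 (by omega) (by omega) (by omega), A 7 4 (by omega) (by omega) (by omega), c24, c29, c25, c47] at j2
  rw [A 7 5 (by omega) (by omega) (by omega), A 9 3 (by omega) (by omega) (by omega), A 5 3 (by omega) (by omega) (by omega), A 8 4 (by omega) (by omega) (by omega), c57, c39, c35, c48] at j3
  generalize c 2 3 = t at *
  generalize c 3 4 = a at *
  generalize c 4 5 = b at *
  generalize c 5 6 = d at *
  have k1 : b * (2 * t + a) = 3 * a^2 := by linear_combination -j1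
  have k2 : d * (a + b - 2 * t) = 6 * b^2 - 4 * a * b := by linear_combination j2
  have k3 : d * (3 * (a + b)) = 4 * b^2 := by linear_combination -j3
  clear j1 j2 j3
  constructor
  · rintro rfl
    by_contra ha
    have hb : b = 3 * a := by
      apply mul_right_cancel₀ ha; linear_combination k1
    subst hb
    have : a^2 = 0 := by linear_combination (-k2 * 3 + k3) / 90
    exact ha (by simpa using this)
  · intro ht
    by_cases ha : a = 0
    · exact Or.inl ha
    right
    have h1 : 2 * t + a ≠ 0 := by
      intro h; rw [h] at k1; apply ha; simpa using k1.symm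
    obtain ⟨s, rfl⟩ : ∃ s, b = s * a := ⟨b / a, by field_simp⟩
    have k1' : s * (2 * t + a) = 3 * a := by
      apply mul_right_cancel₀ ha; linear_combination k1
    have hs : s ≠ 0 := by
      rintro rfl; apply ha; linarith
    have k3' : d * (3 * (1 + s)) = 4 * s^2 * a := by
      apply mul_right_cancel₀ ha; linear_combination k3
    have e1 : (4 * s^2 * a) * (a + s * a - 2 * t) = 3 * (1 + s) * (6 * s^2 * a^2 - 4 * a^2 * s) := by
      linear_combination 3 * (1 + s) * k2 - (a + s * a - 2 * t) * k3'
    -- cancel a * s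
    have e2 : 2 * s * (a + s * a - 2 * t) = 3 * (1 + s) * (3 * s * a - 2 * a) := by
      apply mul_right_cancel₀ (mul_ne_zero ha hs); linear_combination e1 / 2
    -- eliminate 2 t s = 3 a - a s
    have e3 : 2 * s * (1 + s) + 2 * (s - 3) = 3 * (1 + s) * (3 * s - 2) := by
      apply mul_right_cancel₀ ha; linear_combination e2 + 2 * k1'
    have e4 : s * (7 * s - 1) = 0 := by linear_combination -e3
    have e5 : s = 1 / 7 := by
      have := (mul_eq_zero.1 e4).resolve_left hs; linarith
    subst e5; linarith

open Nat in
noncomputable def vc (t : ℝ) (i j : ℕ) : ℝ :=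
  6 * t * ((j:ℝ) - i) * ((i-2)! : ℕ) * ((j-2)! : ℕ) / ((i+j-2)! : ℕ)

theorem vc_anti (t : ℝ) (i j : ℕ) : vc t i j = - vc t j i := by
  unfold vc; rw [add_comm j i]; ring

theorem vc_rc (t : ℝ) (i j : ℕ) (hi : 2 ≤ i) (hj : 2 ≤ j) :
    vc t (i+1) j + vc t i (j+1) = vc t i j := by
  obtain ⟨a, rfl⟩ := Nat.exists_eq_add_of_le' hi
  obtain ⟨b, rfl⟩ := Nat.exists_eq_add_of_le' hj
  unfold vc
  have e1 : a + 2 + 1 - 2 = a + 1 := by omega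
  have e2 : b + 2 + 1 - 2 = b + 1 := by omega
  have e3 : a + 2 + 1 + (b + 2) - 2 = a + b + 2 + 1 := by omega
  have e4 : a + 2 + (b + 2 + 1) - 2 = a + b + 2 + 1 := by omega
  have e5 : a + 2 + (b + 2) - 2 = a + b + 2 := by omega
  rw [e1, e2, e3, e4, e5, Nat.factorial_succ (a + b + 2), Nat.factorial_succ a, Nat.factorial_succ b]
  simp only [Nat.add_sub_cancel]
  have h := Nat.factorial_ne_zero (a + b + 2)
  have h' : ((a + b + 2).factorial : ℝ) ≠ 0 := by exact_mod_cast h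
  have h3 : (a:ℝ) + b + 2 + 1 ≠ 0 := by positivity
  push_cast
  field_simp
  ring

theorem vc_23 (t : ℝ) : vc t 2 3 = t := by
  norm_num [vc, Nat.factorial]; try ring
theorem vc_34 (t : ℝ) : vc t 3 4 = t / 10 := by
  norm_num [vc, Nat.factorial]; try ring

theorem vc_2 (t : ℝ) (b : ℕ) : vc t 2 (b+2) = 6 * t * b / ((b+1) * (b+2)) := by
  unfold vc
  have e5 : 2 + (b + 2) - 2 = b + 1 + 1 := by omega
  rw [e5, Nat.factorial_succ, Nat.factorial_succ]
  simp only [Nat.add_sub_cancel]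
  have h' : (b.factorial : ℝ) ≠ 0 := by exact_mod_cast Nat.factorial_ne_zero b
  push_cast
  norm_num
  field_simp
  try ring

theorem vc_3 (t : ℝ) (b : ℕ) : vc t 3 (b+2) = 6 * t * (b - 1) / ((b+1) * (b+2) * (b+3)) := by
  have := vc_rc t 2 (b+2) (by omega) (by omega)
  have h1 := vc_2 t (b+1)
  rw [show b + 2 + 1 = b + 1 + 2 by omega, h1, vc_2] at this
  norm_num at this
  have e : vc t 3 (b+2) = 6 * t * b / ((b+1) * (b+2)) - 6 * t * (b+1) / ((b+1+1) * (b+1+2)) := by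
    push_cast at this; linarith
  rw [e]
  have h3 : (b:ℝ) + 1 + 1 ≠ 0 := by positivity
  have h4 : (b:ℝ) + 1 + 2 ≠ 0 := by positivity
  field_simp
  ring

theorem vc_jac (t : ℝ) (l : ℕ) (hl : 4 ≤ l) :
    vc t 2 3 * vc t 5 l + vc t 3 l * vc t (3+l) 2 + vc t l 2 * vc t (l+2) 3 = 0 := by
  obtain ⟨b, rfl⟩ := Nat.exists_eq_add_of_le' (show 2 ≤ l by omega)
  rw [vc_anti t (3 + (b+2)), vc_anti t (b+2) 2, vc_anti t (b+2+2) 3]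
  have h5 := vc_rc t 3 (b+2) (by omega) (by omega)
  have h6 := vc_rc t 3 (b+3) (by omega) (by omega)
  have h7 := vc_rc t 4 (b+2) (by omega) (by omega)
  norm_num at h5 h6 h7
  have e5 : vc t 5 (b+2) = vc t 3 (b+2) - 2 * vc t 3 (b+3) + vc t 3 (b+4) := by linarith
  rw [e5, vc_23, show 3 + (b+2) = (b+3)+2 by omega]
  have h31 := vc_3 t (b+1)
  have h32 := vc_3 t (b+2)
  rw [show b + 1 + 2 = b + 3 by omega] at h31
  rw [show b + 2 + 2 = b + 4 by omega] at h32
  rw [show b + 2 + 2 = b + 4 by omega, h31, h32, vc_3, vc_2, vc_2]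
  push_cast
  have h1 : (b:ℝ) + 1 + 1 ≠ 0 := by positivity
  have h2 : (b:ℝ) + 1 + 2 ≠ 0 := by positivity
  have h3 : (b:ℝ) + 1 + 3 ≠ 0 := by positivity
  have h4 : (b:ℝ) + 2 + 1 ≠ 0 := by positivity
  have h5 : (b:ℝ) + 2 + 2 ≠ 0 := by positivity
  have h6 : (b:ℝ) + 2 + 3 ≠ 0 := by positivity
  have h7 : (b:ℝ) + 3 + 1 ≠ 0 := by positivity
  have h8 : (b:ℝ) + 3 + 2 ≠ 0 := by positivity
  field_simp
  ring

theorem vc_co (t : ℝ) (ht : t ≠ 0) (l : ℕ) (hl : 4 ≤ l) :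
    vc t 2 3 + vc t 3 l + vc t 2 l ≠ 0 := by
  obtain ⟨b, rfl⟩ := Nat.exists_eq_add_of_le' (show 3 ≤ l by omega)
  rw [show b + 3 = (b + 1) + 2 by omega, vc_23, vc_3, vc_2]
  push_cast
  have : t + 6 * t * ((b:ℝ) + 1 - 1) / ((b + 1 + 1) * (b + 1 + 2) * (b + 1 + 3)) + 6 * t * (b + 1) / ((b + 1 + 1) * (b + 1 + 2))
    = t * (1 + 6 * b / ((b + 1 + 1) * (b + 1 + 2) * (b + 1 + 3)) + 6 * (b + 1) / ((b + 1 + 1) * (b + 1 + 2))) := by ring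
  rw [this]
  apply mul_ne_zero ht
  positivity

/-- the algebra m_2 -/
noncomputable def mc (t : ℝ) (i j : ℕ) : ℝ :=
  (if i = 2 ∧ 2 < j then t else 0) - (if j = 2 ∧ 2 < i then t else 0)

theorem core (N : ℕ) (c : ℕ → ℕ → ℝ) (hc : Sys N c) (hN : 13 ≤ N) (hodd : Odd N)
    (nd2 : c 2 (N-2) ≠ 0) (nd3 : c 3 (N-3) ≠ 0) :
    (∀ i j, 2 ≤ i → 2 ≤ j → i + j < N → c i j = 0) ∨
    ∃ t, t ≠ 0 ∧ ∀ i j, 2 ≤ i → 2 ≤ j → i + j ≤ N → c i j = vc t i j := by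
  obtain ⟨l1, l2⟩ := low N c hc (by omega)
  by_cases h23 : c 2 3 = 0
  · left
    have h34 := l1 h23
    by_contra hcon
    have hex : ∃ L, L < N ∧ ∃ i j, 2 ≤ i ∧ 2 ≤ j ∧ i + j = L ∧ c i j ≠ 0 := by
      push Not at hcon
      obtain ⟨i, j, hi, hj, h, h'⟩ := hcon
      exact ⟨i + j, h, i, j, hi, hj, rfl, h'⟩
    classical
    set L := Nat.find hex with hLdef
    obtain ⟨hLN, i, j, hi, hj, hij, hne⟩ := Nat.find_spec hex
    rw [← hLdef] at hLN hij
    have hz : ∀ i j, 2 ≤ i → 2 ≤ j → i + j < L → c i j = 0 := by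
      intro i j hi hj h
      by_contra h'
      exact Nat.find_min hex h ⟨by omega, i, j, hi, hj, rfl, h'⟩
    have f0 := alt_lem (fun i => c i (L - i)) (fun _ => c 2 (L-2)) (L-2) (by
      intro i hi hb
      obtain ⟨p, hp⟩ : ∃ p, L = i + p + 1 := ⟨L - i - 1, by omega⟩
      have e1 : L - (i+1) = p := by omega
      have e2 : L - i = p + 1 := by omega
      simp only [e1, e2]
      rw [hc.rc i p hi (by omega) (by omega), hz i p hi (by omega) (by omega)]
      ring) rfl
    have h2 : c 2 (L-2) ≠ 0 := by
      intro h
      have := f0 i hi (by omega)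
      simp only [h] at this
      rw [show L - i = j by omega] at this
      apply hne; simpa using this
    have hLodd : Odd L := by
      rw [← Nat.not_even_iff_odd]
      rintro ⟨m, hm⟩
      have := f0 m (by omega) (by omega)
      simp only [show L - m = m by omega] at this
      have h' := hc.anti m m (by omega) (by omega) (by omega)
      have h'' : c m m = 0 := by linarith
      rw [h''] at this
      simp [h2] at this
    have n5 : L ≠ 5 := by
      intro h; rw [h] at h2; exact h2 h23
    have n7 : L ≠ 7 := by
      intro h
      have := f0 3 (by omega) (by omega)
      simp only [h] at this h2
      norm_num [h34] at this
      exact h2 this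
    obtain ⟨r, hr⟩ := hLodd
    obtain ⟨s, hs⟩ := hodd
    exact high N L c hc (by omega) ⟨r, hr⟩ hz h2 (by omega) nd2
  · rcases l2 h23 with h34 | h34
    · exfalso
      apply nd3
      have := uniq N c (mc (c 2 3)) hc
        (by intro i j _ _ _; unfold mc; ring)
        (by
          intro i j hi hj _
          unfold mc
          rcases eq_or_lt_of_le hi with rfl | hi' <;> rcases eq_or_lt_of_le hj with rfl | hj'
          · simp
          · simp [hj', show 2 < j + 1 by omega, show j ≠ 2 by omega]
          · simp [hi', show 2 < i + 1 by omega, show i ≠ 2 by omega]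
          · simp [show i ≠ 2 by omega, show i + 1 ≠ 2 by omega, show j ≠ 2 by omega, show j + 1 ≠ 2 by omega])
        (by
          intro l hl _
          unfold mc
          simp [show 2 < l by omega, show l ≠ 2 by omega, show 2 < 3 + l by omega, show l ≠ 0 by omega])
        (by
          intro l hl _
          unfold mc
          simp [show 2 < l by omega, show l ≠ 2 by omega, h23])
        (by simp [mc]) (by simp [mc, h34]) N 3 (N-3) (by omega) (by omega) (by omega) le_rfl
      rw [this]
      simp [mc, show N - 3 ≠ 2 by omega]
    · right
      refine ⟨c 2 3, h23, ?_⟩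
      intro i j hi hj hij
      exact uniq N c (vc (c 2 3)) hc (fun i j _ _ _ => vc_anti _ i j)
        (fun i j hi hj _ => vc_rc _ i j hi hj) (fun l hl _ => vc_jac _ l hl)
        (fun l hl _ => vc_co _ h23 l hl) (vc_23 _).symm (by rw [vc_34, h34]) _ i j hi hj rfl hij

theorem span1 {g : Type*} [AddCommGroup g] [Module ℝ g] (p : Submodule ℝ g)
    (h : Module.finrank ℝ p = 1) : ∃ u : g, p = Submodule.span ℝ {u} := by
  obtain ⟨v, hv, hw⟩ := finrank_eq_one_iff'.1 h
  refine ⟨v, le_antisymm ?_ ?_⟩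
  · intro x hx
    obtain ⟨c, hc⟩ := hw ⟨x, hx⟩
    rw [Submodule.mem_span_singleton]
    exact ⟨c, by simpa using congrArg Subtype.val hc⟩
  · rw [Submodule.span_singleton_le_iff_mem]; exact v.2

theorem exists_e {g : Type*} [LieRing g] [LieAlgebra ℝ g]
    (k : ℕ) (hk : 12 ≤ 2 * k)
    (hdim : Module.finrank ℝ g = 2 * k)
    (gr : ℕ → Submodule ℝ g)
    (h0 : gr 0 = ⊥)
    (htop : ∀ α : ℕ, 2 * k < α → gr α = ⊥)
    (hbr : ∀ (α β : ℕ) (x y : g), x ∈ gr α → y ∈ gr β → ⁅x, y⁆ ∈ gr (α + β))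
    (hsup : (⨆ α : ℕ, gr α) = ⊤)
    (hdim1 : ∀ α : ℕ, 1 ≤ α → α ≤ 2 * k → Module.finrank ℝ (gr α) = 1)
    (hgen : ∀ α : ℕ, 2 ≤ α → α ≤ 2 * k - 1 →
      Submodule.span ℝ {z : g | ∃ x ∈ gr 1, ∃ y ∈ gr α, z = ⁅x, y⁆} = gr (α + 1)) :
    ∃ (e : ℕ → g) (c : ℕ → ℕ → ℝ) (b : Basis (Fin (2*k)) ℝ g),
      e 0 = 0 ∧ (∀ i, 2 * k < i → e i = 0) ∧ (∀ i, 2 ≤ i → ⁅e 1, e i⁆ = e (i+1)) ∧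
      (∀ i j, ⁅e i, e j⁆ = c i j • e (i + j)) ∧ (∀ i : Fin (2*k), e (i+1) = b i) := by
  obtain ⟨u, hu⟩ := span1 _ (hdim1 1 (by omega) (by omega))
  obtain ⟨v, hv⟩ := span1 _ (hdim1 2 (by omega) (by omega))
  let e : ℕ → g := fun i => match i with
    | 0 => 0
    | 1 => u
    | (i+2) => (fun x => ⁅u, x⁆)^[i] v
  have e0 : e 0 = 0 := rfl
  have e1 : e 1 = u := rfl
  have e2 : e 2 = v := rfl
  have es : ∀ i, 2 ≤ i → ⁅e 1, e i⁆ = e (i+1) := by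
    intro i hi
    obtain ⟨a, rfl⟩ := Nat.exists_eq_add_of_le' hi
    change ⁅u, (fun x => ⁅u, x⁆)^[a] v⁆ = (fun x => ⁅u, x⁆)^[a+1] v
    rw [Function.iterate_succ_apply']
  have hs2 : ∀ i, 2 ≤ i → gr i = Submodule.span ℝ {e i} := by
    intro i hi
    induction i, hi using Nat.le_induction with
    | base => exact hv
    | succ i hi ih =>
      have hmem : e (i+1) ∈ gr (i+1) := by
        rw [← es i hi, add_comm]
        apply hbr
        · rw [hu, e1]; exact Submodule.mem_span_singleton_self _
        · rw [ih]; exact Submodule.mem_span_singleton_self _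
      by_cases h : i ≤ 2 * k - 1
      · apply le_antisymm
        · rw [← hgen i hi h, Submodule.span_le]
          rintro z ⟨x, hx, y, hy, rfl⟩
          rw [hu, Submodule.mem_span_singleton] at hx
          rw [ih, Submodule.mem_span_singleton] at hy
          obtain ⟨a, rfl⟩ := hx
          obtain ⟨b, rfl⟩ := hy
          have := es i hi
          rw [e1] at this
          rw [smul_lie, lie_smul, this]
          exact Submodule.smul_mem _ _ (Submodule.smul_mem _ _ (Submodule.mem_span_singleton_self _))
        · rw [Submodule.span_singleton_le_iff_mem]; exact hmem
      · have := htop (i+1) (by omega)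
        rw [this] at hmem ⊢
        rw [(Submodule.mem_bot ℝ).1 hmem]; simp
  have hs : ∀ i, gr i = Submodule.span ℝ {e i} := by
    intro i
    match i with
    | 0 => rw [h0, e0]; simp
    | 1 => exact hu
    | (i+2) => exact hs2 _ (by omega)
  have ebig : ∀ i, 2 * k < i → e i = 0 := by
    intro i hi
    have := hs i
    rw [htop i hi] at this
    exact Submodule.span_singleton_eq_bot.1 this.symm
  have hmem : ∀ i, e i ∈ gr i := by
    intro i; rw [hs]; exact Submodule.mem_span_singleton_self _
  have hc : ∀ i j, ∃ c : ℝ, ⁅e i, e j⁆ = c • e (i+j) := by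
    intro i j
    have := hbr i j _ _ (hmem i) (hmem j)
    rw [hs, Submodule.mem_span_singleton] at this
    obtain ⟨c, hc⟩ := this
    exact ⟨c, hc.symm⟩
  choose c hc using hc
  have hspan : (⊤ : Submodule ℝ g) ≤ Submodule.span ℝ (Set.range (fun i : Fin (2*k) => e (i+1))) := by
    rw [← hsup]
    apply iSup_le
    intro i
    rw [hs, Submodule.span_singleton_le_iff_mem]
    by_cases h : 1 ≤ i ∧ i ≤ 2 * k
    · apply Submodule.subset_span
      refine ⟨⟨i - 1, by omega⟩, ?_⟩
      simp only
      congr 1; omega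
    · have : e i = 0 := by
        rcases Nat.eq_zero_or_pos i with rfl | h'
        · exact e0
        · exact ebig i (by omega)
      rw [this]; exact Submodule.zero_mem _
  refine ⟨e, c, basisOfTopLeSpanOfCardEqFinrank _ hspan (by simp [hdim]), e0, ebig, es, hc, ?_⟩
  intro i; simp

theorem omega_facts {g : Type*} [LieRing g] [LieAlgebra ℝ g]
    (k : ℕ) (hk : 12 ≤ 2 * k) (e : ℕ → g) (c : ℕ → ℕ → ℝ) (b : Basis (Fin (2*k)) ℝ g)
    (e0 : e 0 = 0) (ebig : ∀ i, 2 * k < i → e i = 0) (es : ∀ i, 2 ≤ i → ⁅e 1, e i⁆ = e (i+1))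
    (hc : ∀ i j, ⁅e i, e j⁆ = c i j • e (i + j)) (hb : ∀ i : Fin (2*k), e (i+1) = b i)
    (ω : g →ₗ[ℝ] g →ₗ[ℝ] ℝ) (hω : IsSymplecticForm ω) :
    (∀ x y, ω x y = - ω y x) ∧
    (∀ i j, 2 ≤ i → 2 ≤ j →
      ω (e (i+1)) (e j) + ω (e i) (e (j+1)) = c i j * ω (e 1) (e (i+j))) ∧
    (∀ i j l, c i j * ω (e (i+j)) (e l) + c j l * ω (e (j+l)) (e i)
      + c l i * ω (e (l+i)) (e j) = 0) ∧
    ω (e 1) (e (2*k)) ≠ 0 ∧ ω (e 2) (e (2*k-1)) ≠ 0 ∧ ω (e 3) (e (2*k-2)) ≠ 0 := by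
  obtain ⟨alt, nondeg, closed⟩ := hω
  have anti : ∀ x y, ω x y = - ω y x := by
    intro x y
    have := alt (x + y)
    simp only [map_add, LinearMap.add_apply, alt] at this
    linarith
  have rel : ∀ i j, 2 ≤ i → 2 ≤ j →
      ω (e (i+1)) (e j) + ω (e i) (e (j+1)) = c i j * ω (e 1) (e (i+j)) := by
    intro i j hi hj
    have := closed (e 1) (e i) (e j)
    rw [es i hi, hc i j, ← lie_skew, es j hj] at this
    simp only [map_smul, map_neg, LinearMap.smul_apply, LinearMap.neg_apply, smul_eq_mul] at this
    rw [anti (e (i+j)), anti (e (j+1))] at this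
    linarith
  have z : ∀ i j, 2 ≤ i → 2 ≤ j → 2 * k + 2 ≤ i + j → ω (e i) (e j) = 0 := by
    intro i j hi hj hij
    obtain ⟨S, hS⟩ : ∃ S, S = i + j := ⟨_, rfl⟩
    have f0 := alt_lem (fun i => ω (e i) (e (S - i))) (fun _ => ω (e 2) (e (S-2))) (S-2) (by
      intro i hi hb
      obtain ⟨p, hp⟩ : ∃ p, S = i + p + 1 := ⟨S - i - 1, by omega⟩
      have e1 : S - (i+1) = p := by omega
      have e2 : S - i = p + 1 := by omega
      simp only [e1, e2]
      rw [rel i p hi (by omega), ebig (i+p) (by omega)]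
      simp) rfl
    have h2 : ω (e 2) (e (S-2)) = 0 := by
      by_cases hS' : S = 2 * k + 2
      · have := f0 (k+1) (by omega) (by omega)
        simp only [show S - (k+1) = k+1 by omega, alt] at this
        simpa using this
      · rw [ebig (S-2) (by omega)]; simp
    have := f0 i hi (by omega)
    simp only [h2, show S - i = j by omega] at this
    simpa using this
  have ext0 : ∀ x, (∀ i, 1 ≤ i → i ≤ 2 * k → ω x (e i) = 0) → x = 0 := by
    intro x hx
    apply nondeg
    have : ω x = 0 := by
      apply b.ext
      intro i
      rw [← hb, hx _ (by omega) (by omega)]; simp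
    intro y; simp [this]
  have be : ∀ i (h1 : 1 ≤ i) (h2 : i ≤ 2 * k), e i = b ⟨i - 1, by omega⟩ := by
    intro i h1 h2
    rw [← hb]; simp only; congr 1; omega
  have w1 : ω (e (2*k)) (e 1) ≠ 0 := by
    intro h
    have h0 : e (2*k) = 0 := by
      apply ext0
      intro i h1 h2
      rcases eq_or_lt_of_le h1 with rfl | h3
      · exact h
      · exact z _ _ (by omega) (by omega) (by omega)
    rw [be _ (by omega) (by omega)] at h0
    exact b.ne_zero _ h0
  have w2 : ω (e (2*k-1)) (e 2) ≠ 0 := by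
    intro h
    have h0 : e (2*k-1) - (ω (e (2*k-1)) (e 1) / ω (e (2*k)) (e 1)) • e (2*k) = 0 := by
      apply ext0
      intro i h1 h2
      simp only [map_sub, map_smul, LinearMap.sub_apply, LinearMap.smul_apply, smul_eq_mul]
      rcases eq_or_lt_of_le h1 with rfl | h3
      · field_simp; ring
      rw [z (2*k) i (by omega) (by omega) (by omega)]
      by_cases h4 : i = 2
      · subst h4; rw [h]; ring
      · rw [z _ i (by omega) (by omega) (by omega)]; ring
    rw [be (2*k) (by omega) (by omega), be (2*k-1) (by omega) (by omega)] at h0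
    have h1 := congrArg (fun x => b.repr x ⟨2*k-1-1, by omega⟩) h0
    simp [Finsupp.single_apply, show 2*k-1 ≠ 2*k-1-1 by omega] at h1
  have w3 : ω (e (2*k-2)) (e 3) ≠ 0 := by
    intro h
    obtain ⟨α, hα⟩ : ∃ α, α * ω (e (2*k-1)) (e 2) = ω (e (2*k-2)) (e 2) :=
      ⟨_, div_mul_cancel₀ _ w2⟩
    obtain ⟨β, hβ⟩ : ∃ β, β * ω (e (2*k)) (e 1) = ω (e (2*k-2)) (e 1) - α * ω (e (2*k-1)) (e 1) :=
      ⟨_, div_mul_cancel₀ _ w1⟩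
    have h0 : e (2*k-2) - α • e (2*k-1) - β • e (2*k) = 0 := by
      apply ext0
      intro i h1 h2
      simp only [map_sub, map_smul, LinearMap.sub_apply, LinearMap.smul_apply, smul_eq_mul]
      rcases eq_or_lt_of_le h1 with rfl | h3
      · rw [hβ]; ring
      rw [z (2*k) i (by omega) (by omega) (by omega)]
      by_cases h4 : i = 2
      · subst h4; rw [hα]; ring
      rw [z (2*k-1) i (by omega) (by omega) (by omega)]
      by_cases h5 : i = 3
      · subst h5; rw [h]; ring
      · rw [z _ i (by omega) (by omega) (by omega)]; ring
    rw [be (2*k) (by omega) (by omega), be (2*k-1) (by omega) (by omega), be (2*k-2) (by omega) (by omega)] at h0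
    have h1 := congrArg (fun x => b.repr x ⟨2*k-2-1, by omega⟩) h0
    simp [Finsupp.single_apply, show 2*k-1 ≠ 2*k-2-1 by omega, show 2*k-1-1 ≠ 2*k-2-1 by omega] at h1
  refine ⟨anti, rel, ?_, ?_, ?_, ?_⟩
  · intro i j l
    have := closed (e i) (e j) (e l)
    rw [hc i j, hc j l, hc l i] at this
    simpa using this
  · rw [anti]; simpa using w1
  · rw [anti]; simpa using w2
  · rw [anti]; simpa using w3

/-- a real Lie algebra `g` of dimension `2k ≥ 12`, graded as
`g = g_1 ⊕ … ⊕ g_{2k}` with `dim g_α = 1` for `1 ≤ α ≤ 2k` and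
`[g_1, g_α] = g_{α+1}` for `2 ≤ α ≤ 2k - 1`, which admits a symplectic structure, is
isomorphic either to `m_0(2k)` or to `V_{2k}`. -/
theorem statement10 {g : Type*} [LieRing g] [LieAlgebra ℝ g]
    (k : ℕ) (hk : 12 ≤ 2 * k)
    (hdim : Module.finrank ℝ g = 2 * k)
    (gr : ℕ → Submodule ℝ g)
    (h0 : gr 0 = ⊥)
    (htop : ∀ α : ℕ, 2 * k < α → gr α = ⊥)
    (hbr : ∀ (α β : ℕ) (x y : g), x ∈ gr α → y ∈ gr β → ⁅x, y⁆ ∈ gr (α + β))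
    (hsup : (⨆ α : ℕ, gr α) = ⊤)
    (hdim1 : ∀ α : ℕ, 1 ≤ α → α ≤ 2 * k → Module.finrank ℝ (gr α) = 1)
    (hgen : ∀ α : ℕ, 2 ≤ α → α ≤ 2 * k - 1 →
      Submodule.span ℝ {z : g | ∃ x ∈ gr 1, ∃ y ∈ gr α, z = ⁅x, y⁆} = gr (α + 1))
    (hsympl : ∃ ω : g →ₗ[ℝ] g →ₗ[ℝ] ℝ, IsSymplecticForm ω) :
    (∃ E : ℕ → g, IsM0Basis ℝ (2 * k) E) ∨ (∃ E : ℕ → g, IsVnBasis ℝ (2 * k) E) := by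
  obtain ⟨ω, hω⟩ := hsympl
  obtain ⟨e, c, b, e0, ebig, es, hc, hb⟩ := exists_e k hk hdim gr h0 htop hbr hsup hdim1 hgen
  obtain ⟨anti, rel, clo, w1, w2, w3⟩ := omega_facts k hk e c b e0 ebig es hc hb ω hω
  have ene : ∀ i, 1 ≤ i → i ≤ 2 * k → e i ≠ 0 := by
    intro i h1 h2
    have := hb ⟨i - 1, by omega⟩
    simp only [show i - 1 + 1 = i by omega] at this
    rw [this]; exact b.ne_zero _
  set w := ω (e 1) (e (2*k)) with hw
  let d : ℕ → ℕ → ℝ := fun i j => if i + j = 2 * k + 1 then ω (e i) (e j) / w else c i j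
  have d1 : ∀ i j, i + j = 2 * k + 1 → d i j = ω (e i) (e j) / w := fun i j h => if_pos h
  have d2 : ∀ i j, i + j ≤ 2 * k → d i j = c i j := fun i j h => if_neg (by omega)
  have sys : Sys (2*k+1) d := by
    refine ⟨?_, ?_, ?_⟩
    · intro i j hi hj hij
      by_cases h : i + j = 2 * k + 1
      · rw [d1 i j h, d1 j i (by omega), anti]; ring
      · rw [d2 i j (by omega), d2 j i (by omega)]
        have h1 := lie_skew (e i) (e j)
        rw [hc, hc, add_comm j i, ← neg_smul] at h1
        exact (smul_left_injective ℝ (ene (i+j) (by omega) (by omega)) h1).symm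
    · intro i j hi hj hij
      by_cases h : i + j = 2 * k
      · rw [d1 (i+1) j (by omega), d1 i (j+1) (by omega), d2 i j (by omega), ← add_div,
          rel i j hi hj, h]
        exact mul_div_cancel_right₀ _ w1
      · rw [d2 (i+1) j (by omega), d2 i (j+1) (by omega), d2 i j (by omega)]
        have h1 := leibniz_lie (e 1) (e i) (e j)
        rw [hc i j, lie_smul, es i hi, es j hj, es (i+j) (by omega), hc (i+1) j, hc i (j+1),
          show i + 1 + j = i + j + 1 by omega, show i + (j + 1) = i + j + 1 by omega, ← add_smul] at h1
        exact (smul_left_injective ℝ (ene (i+j+1) (by omega) (by omega)) h1).symm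
    · intro i j l hi hj hl hij
      rw [d2 i j (by omega), d2 j l (by omega), d2 l i (by omega)]
      by_cases h : i + j + l = 2 * k + 1
      · rw [d1 (i+j) l (by omega), d1 (j+l) i (by omega), d1 (l+i) j (by omega)]
        have := clo i j l
        field_simp
        linarith
      · rw [d2 (i+j) l (by omega), d2 (j+l) i (by omega), d2 (l+i) j (by omega)]
        have h1 := lie_jacobi (e i) (e j) (e l)
        rw [← lie_skew (e i), ← lie_skew (e j) ⁅e l, e i⁆, ← lie_skew (e l) ⁅e i, e j⁆, hc j l, hc l i, hc i j,
          smul_lie, smul_lie, smul_lie, hc, hc, hc,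
          show j + l + i = i + j + l by omega, show l + i + j = i + j + l by omega,
          smul_smul, smul_smul, smul_smul, ← neg_smul, ← neg_smul, ← neg_smul, ← add_smul, ← add_smul] at h1
        have := (smul_eq_zero.1 h1).resolve_right (ene _ (by omega) (by omega))
        linarith
  have cr := core (2*k+1) d sys (by omega) ⟨k, rfl⟩
    (by rw [d1 _ _ (by omega)]; exact div_ne_zero w2 w1)
    (by rw [d1 _ _ (by omega)]; exact div_ne_zero w3 w1)
  have ez : ∀ m : ℕ, m = 0 ∨ 2 * k < m → e m = 0 := by
    rintro m (rfl | h)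
    · exact e0
    · exact ebig m h
  rcases cr with cr | ⟨t, ht, cr⟩
  · left
    refine ⟨e, ⟨b, hb⟩, ez, fun i h1 _ => es i h1, ?_, ?_⟩
    · rw [es _ (by omega), ebig _ (by omega)]
    · intro i j hi hij hj
      rw [hc]
      by_cases h : i + j ≤ 2 * k
      · rw [← d2 i j h, cr i j hi (by omega) (by omega), zero_smul]
      · rw [ebig _ (by omega), smul_zero]
  · right
    let s : ℕ → ℝ := fun i => if i ≤ 1 then 1 else 1 / (6 * t * ((i-2).factorial : ℕ))
    have s1 : s 1 = 1 := rfl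
    have s2 : ∀ a, s (a+2) = 1 / (6 * t * (a.factorial : ℕ)) := fun a => if_neg (by omega)
    have fne : ∀ a : ℕ, (a.factorial : ℝ) ≠ 0 := fun a => by exact_mod_cast Nat.factorial_ne_zero a
    have sne : ∀ i, s i ≠ 0 := by
      intro i
      by_cases h : i ≤ 1
      · simp [s, h]
      · obtain ⟨a, rfl⟩ := Nat.exists_eq_add_of_le' (show 2 ≤ i by omega)
        rw [s2]
        exact one_div_ne_zero (mul_ne_zero (mul_ne_zero (by norm_num) ht) (fne a))
    refine ⟨fun i => s i • e i, ⟨b.isUnitSMul (w := fun i => s (i+1)) (fun i => (sne _).isUnit), ?_⟩, ?_, ?_⟩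
    · intro i
      rw [Basis.isUnitSMul_apply, ← hb]
    · intro m hm
      simp only [ez m hm, smul_zero]
    · intro i j hi hij hj
      simp only [smul_lie, lie_smul]
      obtain ⟨q, rfl⟩ := Nat.exists_eq_add_of_le' (show 2 ≤ j by omega)
      rcases eq_or_lt_of_le hi with rfl | hi
      · rw [es _ (by omega), s1, one_smul, smul_smul, show 1 + (q + 2) = (q + 1) + 2 by omega, s2, s2,
          show q + 2 + 1 = q + 1 + 2 by omega, Nat.factorial_succ]
        congr 1
        have := fne q
        push_cast
        field_simp
        ring
      · obtain ⟨p, rfl⟩ := Nat.exists_eq_add_of_le' (show 2 ≤ i by omega)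
        rw [hc]
        by_cases h : p + 2 + (q + 2) ≤ 2 * k
        · rw [← d2 _ _ h, cr _ _ (by omega) (by omega) (by omega), smul_smul, smul_smul, smul_smul]
          congr 1
          rw [s2, s2, show p + 2 + (q + 2) = (p + q + 2) + 2 by omega, s2]
          unfold vc
          rw [show p + 2 + (q + 2) - 2 = p + q + 2 by omega]
          simp only [Nat.add_sub_cancel]
          have h1 := fne p
          have h2 := fne q
          have h3 := fne (p + q + 2)
          field_simp
        · rw [ebig _ (by omega)]; simp

end Paper
end

section
/- Let g be a symplectic filiform Lie algebra over ℝ of dimension 2k with 2k ≥ 12. Then there exists a basis e_1, …, e_{2k} of g such that (with the convention e_m = 0 for m > 2k) either (a) [e_1, e_i] − e_{i+1} ∈ span(e_{i+2}, …, e_{2k}) for 2 ≤ i ≤ 2k−1 and [e_i, e_j] ∈ span(e_{i+j+1}, …, e_{2k}) for 2 ≤ i < j ≤ 2k, or (b) [e_i, e_j] − (j−i)·e_{i+j} ∈ span(e_{i+j+1}, …, e_{2k}) for all 1 ≤ i < j ≤ 2k. -/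
namespace Paper

open Module Submodule

/-- The lower central series of a Lie algebra, as submodules:
`lcs K g 0 = C¹g = g` and `lcs K g m = C^{m+1} g = [g, C^m g]`. -/
def lcs (K : Type*) [Field K] (g : Type*) [LieRing g] [LieAlgebra K g] :
    ℕ → Submodule K g
  | 0 => ⊤
  | m + 1 => Submodule.span K {z : g | ∃ x y : g, y ∈ lcs K g m ∧ z = ⁅x, y⁆}

/-- `g` is a filiform Lie algebra of dimension `n`: it is `n`-dimensional, nilpotent,
with nil-index `n - 1`, i.e. `C^{n-1} g ≠ 0` and `C^n g = 0`. -/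
def IsFiliform (K : Type*) [Field K] (g : Type*) [LieRing g] [LieAlgebra K g]
    (n : ℕ) : Prop :=
  Module.finrank K g = n ∧ lcs K g (n - 2) ≠ ⊥ ∧ lcs K g (n - 1) = ⊥

lemma alt (h : ℕ → ℝ) (s t : ℕ) (H : ∀ i, s ≤ i → i + 1 ≤ t → h i + h (i+1) = 0) :
    ∃ A : ℝ, ∀ i, s ≤ i → i ≤ t → h i = (-1)^i * A := by
  refine ⟨(-1)^s * h s, ?_⟩
  intro i hi
  induction i, hi using Nat.le_induction with
  | base => intro _; rw [← mul_assoc, ← pow_add, ← two_mul, pow_mul]; norm_num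
  | succ i hi ih =>
    intro hit
    have h1 := H i hi hit
    rw [ih (by omega)] at h1
    rw [pow_succ]; linarith

lemma alt0 (h : ℕ → ℝ) (s t : ℕ) (H : ∀ i, s ≤ i → i + 1 ≤ t → h i + h (i+1) = 0)
    (p : ℕ) (hp : s ≤ p) (hp' : p ≤ t) (h0 : h p = 0) :
    ∀ i, s ≤ i → i ≤ t → h i = 0 := by
  obtain ⟨A, hA⟩ := alt h s t H
  have h1 := hA p hp hp'
  rw [h0] at h1
  have : A = 0 := by
    rcases mul_eq_zero.1 h1.symm with h | h
    · exact absurd h (pow_ne_zero _ (by norm_num))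
    · exact h
  intro i hi hi'
  rw [hA i hi hi', this, mul_zero]

/-- recursion on arrays -/
def Rec (s N : ℕ) (c : ℕ → ℕ → ℝ) : Prop :=
  (∀ i j, s ≤ i → s ≤ j → i + j ≤ N → c i j = - c j i) ∧
  (∀ i j, s ≤ i → s ≤ j → i + j + 1 ≤ N → c i j = c (i+1) j + c i (j+1))

def Jac (s N : ℕ) (c : ℕ → ℕ → ℝ) : Prop :=
  ∀ i j l, s ≤ i → s ≤ j → s ≤ l → i + j + l ≤ N →
    c i j * c (i+j) l + c j l * c (j+l) i + c l i * c (l+i) j = 0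

lemma Rec.diag {s N : ℕ} {c} (h : Rec s N c) (i : ℕ) (hi : s ≤ i) (hN : 2 * i ≤ N) : c i i = 0 := by
  have := h.1 i i hi hi (by omega); linarith

lemma Rec.step {s N : ℕ} {c} (h : Rec s N c) (w i : ℕ) (hi : s ≤ i) (hi' : i + 1 + s ≤ w) (hw : w ≤ N) :
    c i (w - i) + c (i+1) (w - (i+1)) = c i (w - 1 - i) := by
  have := h.2 i (w - 1 - i) hi (by omega) (by omega)
  rw [this, show w - 1 - i + 1 = w - i by omega, show w - (i+1) = w - 1 - i by omega]; ring

lemma Rec.sub {s N : ℕ} {c d} (h : Rec s N c) (h' : Rec s N d) : Rec s N (fun i j => c i j - d i j) := by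
  refine ⟨fun i j a b e => ?_, fun i j a b e => ?_⟩
  · beta_reduce; rw [h.1 i j a b e, h'.1 i j a b e]; ring
  · beta_reduce; rw [h.2 i j a b e, h'.2 i j a b e]; ring

/-- vanishing in the previous weight gives alternation -/
lemma Rec.altw {s N : ℕ} {c} (h : Rec s N c) (w : ℕ) (hw : w ≤ N)
    (h0 : ∀ i j, s ≤ i → s ≤ j → i + j + 1 = w → c i j = 0) :
    ∃ A : ℝ, ∀ i j, s ≤ i → s ≤ j → i + j = w → c i j = (-1)^i * A := by
  obtain ⟨A, hA⟩ := alt (fun i => c i (w - i)) s (w - s) (fun i hi hi' => by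
    have := h.step w i hi (by omega) hw
    beta_reduce
    rw [this]; exact h0 _ _ hi (by omega) (by omega))
  refine ⟨A, fun i j hi hj e => ?_⟩
  have := hA i hi (by omega)
  beta_reduce at this
  rwa [show w - i = j by omega] at this

lemma neg_one_pow_mul_eq_zero {i : ℕ} {A : ℝ} (h : (-1:ℝ)^i * A = 0) : A = 0 := by
  rcases mul_eq_zero.1 h with h | h
  · exact absurd h (pow_ne_zero _ (by norm_num))
  · exact h

lemma Rec.even {s N : ℕ} {c} (h : Rec s N c) (r : ℕ) (hw : 2 * r ≤ N)
    (h0 : ∀ i j, s ≤ i → s ≤ j → i + j + 1 = 2 * r → c i j = 0) :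
    ∀ i j, s ≤ i → s ≤ j → i + j = 2 * r → c i j = 0 := by
  obtain ⟨A, hA⟩ := h.altw _ hw h0
  intro i j hi hj e
  have hs : s ≤ r := by omega
  have h1 := hA r r hs hs (by omega)
  rw [h.diag r hs hw] at h1
  rw [hA i j hi hj e, neg_one_pow_mul_eq_zero h1.symm, mul_zero]

/-- first nonzero weight is odd -/
lemma Rec.first {s N : ℕ} {c} (h : Rec s N c) (M : ℕ) (hM : M ≤ N) :
    (∀ i j, s ≤ i → s ≤ j → i + j ≤ M → c i j = 0) ∨
    ∃ r A, s ≤ r ∧ 2 * r + 1 ≤ M ∧ A ≠ 0 ∧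
      (∀ i j, s ≤ i → s ≤ j → i + j < 2 * r + 1 → c i j = 0) ∧
      (∀ i j, s ≤ i → s ≤ j → i + j = 2 * r + 1 → c i j = (-1)^i * A) := by
  induction M with
  | zero =>
    left; intro i j hi hj e
    have : i = 0 := by omega
    have : j = 0 := by omega
    subst i j
    exact h.diag 0 hi (by omega)
  | succ M ih =>
    rcases ih (by omega) with h0 | ⟨r, A, h1, h2, h3⟩
    swap
    · right; exact ⟨r, A, h1, by omega, h3⟩
    rcases Nat.even_or_odd' (M+1) with ⟨r, e | e⟩
    · left; intro i j hi hj e'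
      rcases Nat.lt_or_ge (i + j) (M+1) with hlt | hge
      · exact h0 i j hi hj (by omega)
      · exact h.even r (by omega) (fun i j hi hj _ => h0 i j hi hj (by omega)) i j hi hj (by omega)
    · obtain ⟨A, hA⟩ := h.altw (2*r+1) (by omega) (fun i j hi hj _ => h0 i j hi hj (by omega))
      by_cases hA0 : A = 0 ∨ r < s
      · left; intro i j hi hj e'
        rcases Nat.lt_or_ge (i + j) (M+1) with hlt | hge
        · exact h0 i j hi hj (by omega)
        · rcases hA0 with hA0 | hA0
          · rw [hA i j hi hj (by omega), hA0, mul_zero]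
          · omega
      · push Not at hA0
        right
        exact ⟨r, A, hA0.2, by omega, hA0.1, fun i j hi hj _ => h0 i j hi hj (by omega), hA⟩

/-- solving the recursion in a weight -/
lemma Rec.solve {s N : ℕ} {c} (h : Rec s N c) (w : ℕ) (hw : w ≤ N) (f : ℕ → ℝ)
    (hf : ∀ i j, s ≤ i → s ≤ j → i + j + 1 = w → c i j = f i + f (i+1)) :
    ∃ B : ℝ, ∀ i j, s ≤ i → s ≤ j → i + j = w → c i j = f i - (-1)^i * B := by
  obtain ⟨A, hA⟩ := alt (fun i => c i (w - i) - f i) s (w - s) (fun i hi hi' => by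
    have := h.step w i hi (by omega) hw
    have h2 := hf i (w - 1 - i) hi (by omega) (by omega)
    beta_reduce
    linarith)
  refine ⟨-A, fun i j hi hj e => ?_⟩
  have := hA i hi (by omega)
  beta_reduce at this
  rw [show w - i = j by omega] at this
  linarith

lemma Rec.w2 {s N : ℕ} {c} (h : Rec s N c) (r : ℕ) (A : ℝ) (hs : s ≤ r) (hw : 2 * r + 2 ≤ N)
    (hA : ∀ i j, s ≤ i → s ≤ j → i + j = 2 * r + 1 → c i j = (-1)^i * A) :
    ∀ i j, s ≤ i → s ≤ j → i + j = 2 * r + 2 → c i j = (-1)^i * (((r:ℝ) + 1 - i) * A) := by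
  obtain ⟨B, hB⟩ := h.solve (2*r+2) hw (fun i => (-1)^i * (((r:ℝ) + 1 - i) * A)) (by
    intro i j hi hj e
    rw [hA i j hi hj (by omega)]
    push_cast
    rw [pow_succ]; ring)
  have h1 := hB (r+1) (r+1) (by omega) (by omega) (by omega)
  rw [h.diag (r+1) (by omega) (by omega)] at h1
  have hB0 : B = 0 := by
    apply neg_one_pow_mul_eq_zero (i := r+1)
    push_cast at h1; linarith
  intro i j hi hj e
  rw [hB i j hi hj e, hB0]; ring

lemma Rec.w3 {s N : ℕ} {c} (h : Rec s N c) (r : ℕ) (A : ℝ) (hs : s ≤ r) (hw : 2 * r + 3 ≤ N)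
    (hA : ∀ i j, s ≤ i → s ≤ j → i + j = 2 * r + 1 → c i j = (-1)^i * A) :
    ∃ B : ℝ, ∀ i j, s ≤ i → s ≤ j → i + j = 2 * r + 3 →
      c i j = (-1)^i * (((r:ℝ) + 1 - i) * (r + 2 - i) / 2 * A - B) := by
  obtain ⟨B, hB⟩ := h.solve (2*r+3) hw (fun i => (-1)^i * (((r:ℝ) + 1 - i) * (r + 2 - i) / 2 * A)) (by
    intro i j hi hj e
    rw [h.w2 r A hs (by omega) hA i j hi hj (by omega)]
    push_cast
    rw [pow_succ]; ring)
  refine ⟨B, fun i j hi hj e => ?_⟩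
  rw [hB i j hi hj e]; ring

lemma Rec.w4 {s N : ℕ} {c} (h : Rec s N c) (r : ℕ) (A B : ℝ) (hs : s ≤ r) (hw : 2 * r + 4 ≤ N)
    (hB : ∀ i j, s ≤ i → s ≤ j → i + j = 2 * r + 3 →
      c i j = (-1)^i * (((r:ℝ) + 1 - i) * (r + 2 - i) / 2 * A - B)) :
    ∀ i j, s ≤ i → s ≤ j → i + j = 2 * r + 4 →
      c i j = (-1)^i * (((r:ℝ) + 1 - i) * (r + 2 - i) * (r + 3 - i) / 6 * A - (r + 2 - i) * B) := by
  obtain ⟨C, hC⟩ := h.solve (2*r+4) hw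
    (fun i => (-1)^i * (((r:ℝ) + 1 - i) * (r + 2 - i) * (r + 3 - i) / 6 * A - (r + 2 - i) * B)) (by
    intro i j hi hj e
    rw [hB i j hi hj (by omega)]
    push_cast
    rw [pow_succ]; ring)
  have h1 := hC (r+2) (r+2) (by omega) (by omega) (by omega)
  rw [h.diag (r+2) (by omega) (by omega)] at h1
  have hC0 : C = 0 := by
    apply neg_one_pow_mul_eq_zero (i := r+2)
    push_cast at h1
    have : (r:ℝ) + 2 - (r + 2) = 0 := by ring
    rw [this] at h1
    linarith
  intro i j hi hj e
  rw [hC i j hi hj e, hC0]; ring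

/-- stage 1 combinatorics -/
lemma stage1 {M : ℕ} {c} (h : Rec 1 M c) (hJ : Jac 1 M c) (h12 : c 1 2 = 0) :
    ∀ i j, 1 ≤ i → 1 ≤ j → i + j ≤ M - 1 → c i j = 0 := by
  rcases h.first (M-1) (by omega) with h0 | ⟨r, A, hr, hrM, hA0, hlt, hA⟩
  · exact h0
  exfalso
  have hr2 : 2 ≤ r := by
    by_contra hh
    have : r = 1 := by omega
    subst this
    have h1 := hA 1 2 (by omega) (by omega) (by omega)
    rw [h12] at h1
    exact hA0 (neg_one_pow_mul_eq_zero h1.symm)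
  have h2 := h.w2 r A hr (by omega) hA
  have hj := hJ r (r+1) 1 (by omega) (by omega) (by omega) (by omega)
  rw [hlt (r+1) 1 (by omega) (by omega) (by omega), hlt 1 r (by omega) (by omega) (by omega),
    hA r (r+1) (by omega) (by omega) (by omega), h2 (r+(r+1)) 1 (by omega) (by omega) (by omega)] at hj
  have hj' : (-1:ℝ)^r * ((-1)^(r+(r+1)) * (((r:ℝ)+1 - ((r+(r+1) : ℕ):ℝ)) * A * A)) = 0 := by
    linarith
  have := neg_one_pow_mul_eq_zero (neg_one_pow_mul_eq_zero hj')
  push_cast at this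
  have hr' : (r:ℝ) + 1 - (r + (r+1)) ≠ 0 := by
    have : (2:ℝ) ≤ r := by exact_mod_cast hr2
    intro hh; linarith
  rcases mul_eq_zero.1 this with h | h
  · exact (mul_ne_zero hr' hA0) h
  · exact hA0 h

/-- uniqueness -/
lemma uniq_s11 {N : ℕ} {c d} (h : Rec 2 N c) (hd : Rec 2 N d)
    (hJ : ∀ l, 4 ≤ l → l + 5 ≤ N → c 2 3 * c 5 l - c 3 l * c 2 (l+3) + c 2 l * c 3 (l+2) = 0)
    (hJd : ∀ l, 4 ≤ l → l + 5 ≤ N → d 2 3 * d 5 l - d 3 l * d 2 (l+3) + d 2 l * d 3 (l+2) = 0)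
    (hnz : ∀ l, 4 ≤ l → d 2 3 + d 2 l + d 3 l ≠ 0)
    (h23 : c 2 3 = d 2 3) (h34 : c 3 4 = d 3 4) :
    ∀ i j, 2 ≤ i → 2 ≤ j → i + j ≤ N → c i j = d i j := by
  have hsub := h.sub hd
  rcases hsub.first N le_rfl with h0 | ⟨r, A, hr, hrM, hA0, hlt, hA⟩
  · intro i j hi hj e
    have := h0 i j hi hj e
    beta_reduce at this; linarith
  exfalso
  rcases Nat.lt_or_ge r 4 with hr4 | hr4
  · interval_cases r
    · have := hA 2 3 (by omega) (by omega) (by omega)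
      rw [h23, sub_self] at this
      exact hA0 (neg_one_pow_mul_eq_zero this.symm)
    · have := hA 3 4 (by omega) (by omega) (by omega)
      rw [h34, sub_self] at this
      exact hA0 (neg_one_pow_mul_eq_zero this.symm)
  · obtain ⟨l, hl⟩ : ∃ l, l + 5 = 2 * r + 1 := ⟨2*r+1-5, by omega⟩
    have e1 := hJ l (by omega) (by omega)
    have e2 := hJd l (by omega) (by omega)
    have a1 := hlt 3 l (by omega) (by omega) (by omega)
    have a2 := hlt 2 l (by omega) (by omega) (by omega)
    have b5 := hA 5 l (by omega) (by omega) (by omega)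
    have b2 := hA 2 (l+3) (by omega) (by omega) (by omega)
    have b3 := hA 3 (l+2) (by omega) (by omega) (by omega)
    have a1' : c 3 l = d 3 l := by linarith
    have a2' : c 2 l = d 2 l := by linarith
    rw [h23, a1', a2'] at e1
    have : (d 2 3 + d 2 l + d 3 l) * A = 0 := by
      have c5 : c 5 l = d 5 l - A := by norm_num at b5; linarith
      have c2 : c 2 (l+3) = d 2 (l+3) + A := by norm_num at b2; linarith
      have c3 : c 3 (l+2) = d 3 (l+2) - A := by norm_num at b3; linarith
      rw [c5, c2, c3] at e1
      linarith
    rcases mul_eq_zero.1 this with h | h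
    · exact hnz l (by omega) h
    · exact hA0 h

noncomputable def vv (i j : ℕ) : ℝ :=
  ((j:ℝ) - i) * ((i-2).factorial * (j-2).factorial) / (i+j-2).factorial

lemma vv2 (p q : ℕ) : vv (p+2) (q+2) = ((q:ℝ) - p) * (p.factorial * q.factorial) / (p+q+2).factorial := by
  unfold vv
  rw [show p + 2 + (q+2) - 2 = p+q+2 by omega]
  push_cast; simp

lemma vv_rec (N : ℕ) (t : ℝ) : Rec 2 N (fun i j => t * vv i j) := by
  refine ⟨fun i j hi hj _ => ?_, fun i j hi hj _ => ?_⟩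
  · beta_reduce; unfold vv; rw [add_comm j i]; ring
  · obtain ⟨p, rfl⟩ := Nat.exists_eq_add_of_le' hi
    obtain ⟨q, rfl⟩ := Nat.exists_eq_add_of_le' hj
    beta_reduce
    rw [show p + 2 + 1 = (p+1) + 2 by ring, show q + 2 + 1 = (q+1) + 2 by ring, vv2, vv2, vv2]
    rw [show p + 1 + q + 2 = (p+q+2)+1 by ring, show p + (q+1) + 2 = (p+q+2)+1 by ring]
    simp only [Nat.factorial_succ]
    have h1 : ((p.factorial : ℕ):ℝ) ≠ 0 := by positivity
    have h2 : (((p+q).factorial : ℕ):ℝ) ≠ 0 := by positivity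
    push_cast
    field_simp
    ring

lemma vv_0 (q : ℕ) : vv 2 (q+2) = q / ((q+1)*(q+2)) := by
  have := vv2 0 q
  rw [show 0 + 2 = 2 from rfl, show 0 + q + 2 = q+1+1 by ring] at this
  rw [this]
  simp only [Nat.factorial_succ]
  have h2 : (((q).factorial : ℕ):ℝ) ≠ 0 := by positivity
  push_cast
  field_simp
  simp
  left; ring

lemma vv_1 (q : ℕ) : vv 3 (q+2) = (q-1) / ((q+1)*(q+2)*(q+3)) := by
  have := vv2 1 q
  rw [show 1 + 2 = 3 from rfl, show 1 + q + 2 = q+1+1+1 by ring] at this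
  rw [this]
  simp only [Nat.factorial_succ]
  have h2 : (((q).factorial : ℕ):ℝ) ≠ 0 := by positivity
  push_cast
  field_simp
  simp; ring

lemma vv_3 (q : ℕ) : vv 5 (q+2) = 6 * (q-3) / ((q+1)*(q+2)*(q+3)*(q+4)*(q+5)) := by
  have := vv2 3 q
  rw [show 3 + 2 = 5 from rfl, show 3 + q + 2 = q+1+1+1+1+1 by ring] at this
  rw [this]
  simp only [Nat.factorial_succ]
  have h2 : (((q).factorial : ℕ):ℝ) ≠ 0 := by positivity
  push_cast
  field_simp
  norm_num; ring

lemma vv23 : vv 2 3 = 1/6 := by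
  have := vv_0 1; norm_num at this; rw [this]

lemma vv34 : vv 3 4 = 1/60 := by
  have := vv_1 2; norm_num at this; rw [this]

lemma vv_J (l : ℕ) (hl : 4 ≤ l) : vv 2 3 * vv 5 l - vv 3 l * vv 2 (l+3) + vv 2 l * vv 3 (l+2) = 0 := by
  obtain ⟨q, rfl⟩ := Nat.exists_eq_add_of_le' (show 2 ≤ l by omega)
  rw [vv23, show q + 2 + 3 = (q+3)+2 by ring, vv_0, vv_1, vv_0, vv_1, vv_3]
  push_cast
  have : (0:ℝ) ≤ q := by positivity
  field_simp
  ring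

lemma vv_nz (l : ℕ) (hl : 4 ≤ l) : 0 < vv 2 3 + vv 2 l + vv 3 l := by
  obtain ⟨q, rfl⟩ := Nat.exists_eq_add_of_le' (show 2 ≤ l by omega)
  rw [vv23, vv_0, vv_1]
  have : (2:ℝ) ≤ q := by exact_mod_cast (show 2 ≤ q by omega)
  have : (0:ℝ) ≤ q - 1 := by linarith
  positivity

/-- the model m_2 -/
noncomputable def mm (x : ℝ) (i j : ℕ) : ℝ :=
  if i = 2 then (if j = 2 then 0 else x) else (if j = 2 then -x else 0)

lemma mm_rec (N : ℕ) (x : ℝ) : Rec 2 N (mm x) := by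
  refine ⟨fun i j hi hj _ => ?_, fun i j hi hj _ => ?_⟩
  · unfold mm; split_ifs <;> simp
  · unfold mm; split_ifs <;> first | omega | simp

theorem combi (k : ℕ) (hk : 6 ≤ k) (c : ℕ → ℕ → ℝ) (h : Rec 2 (2*k+1) c) (hJ : Jac 2 (2*k+1) c)
    (hnd2 : c 2 (2*k-1) ≠ 0) (hnd3 : c 3 (2*k-2) ≠ 0) :
    (∀ i j, 2 ≤ i → 2 ≤ j → i + j ≤ 2*k → c i j = 0) ∨
    ∃ t : ℝ, t ≠ 0 ∧ ∀ i j, 2 ≤ i → 2 ≤ j → i + j ≤ 2*k → c i j = t * vv i j := by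
  have hJ' : ∀ l, 4 ≤ l → l + 5 ≤ 2*k+1 → c 2 3 * c 5 l - c 3 l * c 2 (l+3) + c 2 l * c 3 (l+2) = 0 := by
    intro l hl hl'
    have := hJ 2 3 l (by omega) (by omega) (by omega) (by omega)
    rw [h.1 (3+l) 2 (by omega) (by omega) (by omega), h.1 l 2 (by omega) (by omega) (by omega),
      h.1 (l+2) 3 (by omega) (by omega) (by omega), add_comm 3 l] at this
    norm_num at this
    linarith
  -- low-dimensional consequences
  have low : (c 2 3 = 0 ∧ c 3 4 = 0) ∨ (c 2 3 ≠ 0 ∧ (c 3 4 = 0 ∨ c 2 3 = 10 * c 3 4)) := by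
    have R := fun i j (hi : 2 ≤ i) (hj : 2 ≤ j) (e : i + j + 1 ≤ 13) => h.2 i j hi hj (by omega)
    have D := fun i (hi : 2 ≤ i) (e : 2 * i ≤ 13) => h.diag i hi (by omega)
    have S := fun i j (hi : 2 ≤ i) (hj : 2 ≤ j) (e : i + j ≤ 13) => h.1 i j hi hj (by omega)
    set x := c 2 3 with hx
    set y := c 3 4 with hy
    set z := c 4 5 with hz
    set u := c 5 6 with hu
    have c33 := D 3 (by omega) (by omega)
    have c44 := D 4 (by omega) (by omega)
    have c55 := D 5 (by omega) (by omega)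
    have c66 := D 6 (by omega) (by omega)
    have c24 : c 2 4 = x := by have := R 2 3 (by omega) (by omega) (by omega); norm_num at this; linarith
    have c25 : c 2 5 = x - y := by have := R 2 4 (by omega) (by omega) (by omega); norm_num at this; linarith
    have c35 : c 3 5 = y := by have := R 3 4 (by omega) (by omega) (by omega); norm_num at this; linarith
    have c26 : c 2 6 = x - 2*y := by have := R 2 5 (by omega) (by omega) (by omega); norm_num at this; linarith
    have c36 : c 3 6 = y - z := by have := R 3 5 (by omega) (by omega) (by omega); norm_num at this; linarith
    have c27 : c 2 7 = x - 3*y+z := by have := R 2 6 (by omega) (by omega) (by omega); norm_num at this; linarith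
    have c46 : c 4 6 = z := by have := R 4 5 (by omega) (by omega) (by omega); norm_num at this; linarith
    have c37 : c 3 7 = y - 2*z := by have := R 3 6 (by omega) (by omega) (by omega); norm_num at this; linarith
    have c28 : c 2 8 = x - 4*y+3*z := by have := R 2 7 (by omega) (by omega) (by omega); norm_num at this; linarith
    have c47 : c 4 7 = z - u := by have := R 4 6 (by omega) (by omega) (by omega); norm_num at this; linarith
    have c38 : c 3 8 = y - 3*z+u := by have := R 3 7 (by omega) (by omega) (by omega); norm_num at this; linarith
    have c29 : c 2 9 = x - 5*y+6*z-u := by have := R 2 8 (by omega) (by omega) (by omega); norm_num at this; linarith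
    have c57 : c 5 7 = u := by have := R 5 6 (by omega) (by omega) (by omega); norm_num at this; linarith
    have c48 : c 4 8 = z - 2*u := by have := R 4 7 (by omega) (by omega) (by omega); norm_num at this; linarith
    have c39 : c 3 9 = y-4*z+3*u := by have := R 3 8 (by omega) (by omega) (by omega); norm_num at this; linarith
    have j1 := hJ 2 3 4 (by omega) (by omega) (by omega) (by omega)
    have j2 := hJ 2 4 5 (by omega) (by omega) (by omega) (by omega)
    have j3 := hJ 3 4 5 (by omega) (by omega) (by omega) (by omega)
    norm_num at j1 j2 j3
    rw [S 5 4 (by omega) (by omega) (by omega), S 7 2 (by omega) (by omega) (by omega),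
      S 6 3 (by omega) (by omega) (by omega), S 4 2 (by omega) (by omega) (by omega)] at j1
    rw [S 6 5 (by omega) (by omega) (by omega), S 9 2 (by omega) (by omega) (by omega),
      S 7 4 (by omega) (by omega) (by omega), S 5 2 (by omega) (by omega) (by omega)] at j2
    rw [S 7 5 (by omega) (by omega) (by omega), S 9 3 (by omega) (by omega) (by omega),
      S 8 4 (by omega) (by omega) (by omega), S 5 3 (by omega) (by omega) (by omega)] at j3
    rw [← hx, ← hy, ← hz, c27, c24, c36] at j1
    rw [c24, ← hz, ← hu, c29, c25, c47] at j2
    rw [← hy, c57, ← hz, c39, c35, c48] at j3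
    have E1 : z * (2*x+y) = 3*y^2 := by linarith
    have E2 : u * (2*x - y - z) = 4*y*z - 6*z^2 := by linarith
    have E3 : 3 * u * (y+z) = 4*z^2 := by linarith
    clear_value x y z u
    by_cases hx0 : x = 0
    · left
      refine ⟨hx0, ?_⟩
      by_contra hy0
      subst hx0
      have hz3 : z = 3 * y := mul_right_cancel₀ hy0 (by linarith)
      subst hz3
      have hu : u = 21/2 * y := mul_right_cancel₀ hy0 (by linarith)
      subst hu
      apply hy0
      have : y^2 = 0 := by linarith
      simpa using this
    · right
      refine ⟨hx0, ?_⟩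
      by_cases hy0 : y = 0
      · left; exact hy0
      right
      have hz0 : z ≠ 0 := by
        rintro rfl
        apply hy0
        have : y^2 = 0 := by linarith
        simpa using this
      have h7 : y = 7 * z := by
        have : z * z * (y - 7*z) = 0 := by
          linear_combination (2*z) * E1 - (3/2)*(y+z)* E2 + (1/2) * (2*x-y-z) * E3
        have := (mul_eq_zero.1 this).resolve_left (mul_ne_zero hz0 hz0)
        linarith
      subst h7
      apply mul_left_cancel₀ hz0
      linarith
  rcases low with ⟨hx, hy⟩ | ⟨hx, hy | hy⟩
  · -- first nonzero r ≥ 4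
    rcases h.first (2*k) (by omega) with h0 | ⟨r, A, hr, hrM, hA0, hlt, hA⟩
    · left; exact h0
    exfalso
    have hr4 : 4 ≤ r := by
      by_contra hh
      have hh : r < 4 := by omega
      interval_cases r
      · have h1 := hA 2 3 (by omega) (by omega) (by omega)
        rw [hx] at h1
        exact hA0 (neg_one_pow_mul_eq_zero h1.symm)
      · have h1 := hA 3 4 (by omega) (by omega) (by omega)
        rw [hy] at h1
        exact hA0 (neg_one_pow_mul_eq_zero h1.symm)
    have hne : c r (r+1) ≠ 0 := by
      rw [hA r (r+1) (by omega) (by omega) (by omega)]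
      exact mul_ne_zero (pow_ne_zero _ (by norm_num)) hA0
    have z1 : c 2 (2*r+1) = 0 := by
      have hj := hJ r (r+1) 2 (by omega) (by omega) (by omega) (by omega)
      rw [hlt (r+1) 2 (by omega) (by omega) (by omega), hlt 2 r (by omega) (by omega) (by omega),
        h.1 (r+(r+1)) 2 (by omega) (by omega) (by omega), show r + (r+1) = 2*r+1 by ring] at hj
      have : c r (r+1) * c 2 (2*r+1) = 0 := by linarith
      exact (mul_eq_zero.1 this).resolve_left hne
    rcases Nat.lt_or_ge (r+1) k with hrk | hrk
    swap
    · have : r + 1 = k := by omega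
      subst this
      exact hnd2 (by rw [← z1]; congr 1)
    have h2 := h.w2 r A hr (by omega) hA
    have hne2 : c r (r+2) ≠ 0 := by
      rw [h2 r (r+2) (by omega) (by omega) (by omega)]
      refine mul_ne_zero (pow_ne_zero _ (by norm_num)) (mul_ne_zero ?_ hA0)
      intro hh; linarith
    have z2 : c 2 (2*r+2) = 0 := by
      have hj := hJ r (r+2) 2 (by omega) (by omega) (by omega) (by omega)
      rw [hlt (r+2) 2 (by omega) (by omega) (by omega), hlt 2 r (by omega) (by omega) (by omega),
        h.1 (r+(r+2)) 2 (by omega) (by omega) (by omega), show r + (r+2) = 2*r+2 by ring] at hj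
      have : c r (r+2) * c 2 (2*r+2) = 0 := by linarith
      exact (mul_eq_zero.1 this).resolve_left hne2
    obtain ⟨B, hB⟩ := h.w3 r A hr (by omega) hA
    have h4 := h.w4 r A B hr (by omega) hB
    rw [hB 2 (2*r+1) (by omega) (by omega) (by omega)] at z1
    rw [h4 2 (2*r+2) (by omega) (by omega) (by omega)] at z2
    have z1 := neg_one_pow_mul_eq_zero z1
    have z2 := neg_one_pow_mul_eq_zero z2
    push_cast at z1 z2
    have hrr : (4:ℝ) ≤ r := by exact_mod_cast hr4
    have : (r:ℝ) * (r-1) * (2*r-1) * A = 0 := by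
      linear_combination (-6) * z2 + 6 * r * z1
    have hA' : (r:ℝ) * (r-1) * (2*r-1) ≠ 0 := by
      have h1 : (0:ℝ) < r := by linarith
      have h2 : (0:ℝ) < r - 1 := by linarith
      have h3 : (0:ℝ) < 2 * r - 1 := by linarith
      positivity
    exact hA0 ((mul_eq_zero.1 this).resolve_left hA')
  · exfalso
    apply hnd3
    rw [uniq_s11 h (mm_rec _ (c 2 3)) hJ' ?_ ?_ ?_ ?_ 3 (2*k-2) (by omega) (by omega) (by omega)]
    · unfold mm
      rw [if_neg (by omega), if_neg (by omega)]
    · intro l hl _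
      unfold mm
      simp [show l ≠ 2 by omega, show l ≠ 0 by omega]
    · intro l hl
      unfold mm
      simp [show l ≠ 2 by omega, hx]
    · simp [mm]
    · simp [mm, hy]
  · right
    refine ⟨6 * c 2 3, by simpa using hx, fun i j hi hj e => ?_⟩
    refine uniq_s11 (d := fun i j => 6 * c 2 3 * vv i j) h (vv_rec _ _) hJ' ?_ ?_ ?_ ?_ i j hi hj (by omega)
    · intro l hl _
      have := vv_J l hl
      beta_reduce
      linear_combination (6 * c 2 3)^2 * this
    · intro l hl
      have := vv_nz l hl
      beta_reduce
      rw [← mul_add, ← mul_add]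
      exact mul_ne_zero (by simpa using hx) this.ne'
    · beta_reduce; rw [vv23]; ring
    · beta_reduce; rw [vv34, hy]; ring



section
variable {g : Type*} [LieRing g] [LieAlgebra ℝ g]

lemma lcs_lie {m : ℕ} (x : g) {y : g} (hy : y ∈ lcs ℝ g m) : ⁅x, y⁆ ∈ lcs ℝ g (m+1) :=
  Submodule.subset_span ⟨x, y, hy, rfl⟩

lemma lcs_succ_le {m : ℕ} {W : Submodule ℝ g} (h : ∀ x y : g, y ∈ lcs ℝ g m → ⁅x, y⁆ ∈ W) :
    lcs ℝ g (m+1) ≤ W := by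
  show Submodule.span ℝ _ ≤ W
  rw [Submodule.span_le]
  rintro z ⟨x, y, hy, rfl⟩
  exact h x y hy

lemma lcs_anti1 (m : ℕ) : lcs ℝ g (m+1) ≤ lcs ℝ g m := by
  induction m with
  | zero => exact le_top
  | succ m ih => exact lcs_succ_le (fun x y hy => lcs_lie x (ih hy))

lemma lcs_anti : Antitone (lcs ℝ g) := antitone_nat_of_succ_le lcs_anti1

lemma lcs_lie_lcs (i j : ℕ) (x y : g) (hx : x ∈ lcs ℝ g i) (hy : y ∈ lcs ℝ g j) :
    ⁅x, y⁆ ∈ lcs ℝ g (i+j+1) := by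
  induction i generalizing j x y with
  | zero => rw [zero_add]; exact lcs_lie x hy
  | succ i ih =>
    have hx' : x ∈ Submodule.span ℝ {z : g | ∃ x y : g, y ∈ lcs ℝ g i ∧ z = ⁅x, y⁆} := hx
    induction hx' using Submodule.span_induction with
    | mem z hz =>
      obtain ⟨a, b, hb, rfl⟩ := hz
      rw [lie_lie]
      refine Submodule.sub_mem _ ?_ ?_
      · have := lcs_lie a (ih j b y hb hy)
        rwa [show i + 1 + j + 1 = i + j + 1 + 1 by ring]
      · have := ih (j+1) b ⁅a, y⁆ hb (lcs_lie a hy)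
        rwa [show i + 1 + j + 1 = i + (j + 1) + 1 by ring]
    | zero => simp
    | add a b ha hb h1 h2 => rw [add_lie]; exact Submodule.add_mem _ (h1 ha) (h2 hb)
    | smul t a ha h1 => rw [smul_lie]; exact Submodule.smul_mem _ _ (h1 ha)

lemma lcs_stat {m : ℕ} (h : lcs ℝ g (m+1) = lcs ℝ g m) (p : ℕ) : lcs ℝ g (m+p) = lcs ℝ g m := by
  induction p with
  | zero => rfl
  | succ p ih =>
    refine le_antisymm (lcs_anti (by omega)) ?_
    rw [← h]
    refine lcs_succ_le (fun x y hy => ?_)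
    rw [← ih] at hy
    exact lcs_lie x hy

lemma lcs_strict {n : ℕ} (hn : 2 ≤ n) (h : IsFiliform ℝ g n) (m : ℕ) (hm : m + 2 ≤ n) :
    lcs ℝ g (m+1) < lcs ℝ g m := by
  refine lt_of_le_of_ne (lcs_anti1 m) (fun he => ?_)
  have h1 := lcs_stat he (n - 1 - m)
  have h2 := lcs_stat he (n - 2 - m)
  rw [show m + (n - 1 - m) = n - 1 by omega] at h1
  rw [show m + (n - 2 - m) = n - 2 by omega] at h2
  apply h.2.1
  rw [h2, ← h1, h.2.2]

lemma line_lemma [FiniteDimensional ℝ g] {V W : Submodule ℝ g} (hWV : W ≤ V)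
    (hd : finrank ℝ V ≤ finrank ℝ W + 1)
    {x : g} (hx : x ∈ V) (hx' : x ∉ W) {y : g} (hy : y ∈ V) : ∃ t : ℝ, y - t • x ∈ W := by
  have hlt : W < Submodule.span ℝ {x} ⊔ W := by
    refine lt_of_le_of_ne le_sup_right (fun he => hx' ?_)
    rw [he]
    exact Submodule.mem_sup_left (Submodule.mem_span_singleton_self x)
  have hle : Submodule.span ℝ {x} ⊔ W ≤ V := by
    refine sup_le ?_ hWV
    rw [Submodule.span_le]; simpa using hx
  have := Submodule.finrank_lt_finrank_of_lt hlt
  have he := Submodule.eq_of_le_of_finrank_le hle (by omega)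
  rw [← he] at hy
  obtain ⟨a, ha, b, hb, rfl⟩ := Submodule.mem_sup.1 hy
  obtain ⟨t, rfl⟩ := Submodule.mem_span_singleton.1 ha
  exact ⟨t, by simpa using hb⟩

lemma fil_finrank_ge [FiniteDimensional ℝ g] {n : ℕ} (hn : 3 ≤ n) (h : IsFiliform ℝ g n) (d : ℕ) (hd : d + 1 ≤ n) :
    d ≤ finrank ℝ (lcs ℝ g (n-1-d)) := by
  induction d with
  | zero => omega
  | succ d ih =>
    have h1 := ih (by omega)
    have h2 := lcs_strict (by omega) h (n-1-(d+1)) (by omega)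
    have h3 := Submodule.finrank_lt_finrank_of_lt h2
    rw [show n - 1 - (d+1) + 1 = n - 1 - d by omega] at h3
    omega

lemma fil_finrank_one [FiniteDimensional ℝ g] {n : ℕ} (hn : 3 ≤ n) (h : IsFiliform ℝ g n) :
    finrank ℝ (lcs ℝ g 1) + 2 ≤ n := by
  by_contra hc
  have h1 := lcs_strict (by omega) h 0 (by omega)
  have h2 := lcs_strict (by omega) h 1 (by omega)
  have hf : finrank ℝ (lcs ℝ g 0) = n := by
    have : lcs ℝ g 0 = ⊤ := rfl
    rw [this, finrank_top]; exact h.1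
  obtain ⟨x, hx, hx'⟩ := SetLike.exists_of_lt h1
  have hl : ∀ y : g, ∃ t : ℝ, y - t • x ∈ lcs ℝ g 1 := fun y =>
    line_lemma (V := lcs ℝ g 0) h1.le (by show finrank ℝ (lcs ℝ g 0) ≤ finrank ℝ (lcs ℝ g 1) + 1; omega) hx hx' (show y ∈ (⊤ : Submodule ℝ g) from trivial)
  refine not_le_of_gt h2 ?_
  refine lcs_succ_le (fun y z _ => ?_)
  obtain ⟨t, ht⟩ := hl y
  obtain ⟨s, hs⟩ := hl z
  have e : ⁅y, z⁆ = t • ⁅x, z - s • x⁆ - s • ⁅x, y - t • x⁆ + ⁅y - t • x, z - s • x⁆ := by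
    simp only [lie_sub, sub_lie, lie_smul, smul_lie, lie_self]
    rw [← lie_skew y x]
    module
  rw [e]
  refine Submodule.add_mem _ (Submodule.sub_mem _ (Submodule.smul_mem _ _ ?_) (Submodule.smul_mem _ _ ?_)) ?_
  · exact lcs_lie _ hs
  · exact lcs_lie _ ht
  · exact lcs_lie _ hs

lemma fil_finrank [FiniteDimensional ℝ g] {n : ℕ} (hn : 3 ≤ n) (h : IsFiliform ℝ g n) (m : ℕ) (hm : 1 ≤ m) (hm' : m + 1 ≤ n) :
    finrank ℝ (lcs ℝ g m) + m + 1 = n := by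
  have hge := fil_finrank_ge hn h (n-1-m) (by omega)
  rw [show n - 1 - (n-1-m) = m by omega] at hge
  have hle : finrank ℝ (lcs ℝ g m) + m + 1 ≤ n := by
    clear hge
    induction m, hm using Nat.le_induction with
    | base => have := fil_finrank_one hn h; omega
    | succ m hm ih =>
      have h1 := ih (by omega)
      have h2 := Submodule.finrank_lt_finrank_of_lt (lcs_strict (by omega) h m (by omega))
      omega
  omega

structure Adapted (n : ℕ) (G : ℕ → Submodule ℝ g) (D : g) (X : ℕ → g) : Prop where
  top : G 1 = ⊤
  anti : ∀ a b, a ≤ b → G b ≤ G a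
  bot : ∀ m, n ≤ m → G m = ⊥
  lie : ∀ a b, 1 ≤ a → 1 ≤ b → ∀ x ∈ G a, ∀ y ∈ G b, ⁅x, y⁆ ∈ G (a+b)
  mem : ∀ a, 1 ≤ a → X a ∈ G a
  nmem : ∀ a, 1 ≤ a → a < n → X a ∉ G (a+1)
  line : ∀ a, 2 ≤ a → ∀ y ∈ G a, ∃ t : ℝ, y - t • X a ∈ G (a+1)
  line1 : ∀ y, ∃ s t : ℝ, y - s • D - t • X 1 ∈ G 2
  step : ∀ a, 1 ≤ a → ⁅D, X a⁆ = X (a+1)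
  h12 : ⁅X 1, X 2⁆ ∈ G 4
  gen : ∀ b, 1 ≤ b → G (b+1) = Submodule.span ℝ {z : g | ∃ x y : g, y ∈ G b ∧ z = ⁅x, y⁆}

/-- elements acting trivially from `G` to `H` -/
def ell (G H : Submodule ℝ g) : Submodule ℝ g where
  carrier := {x | ∀ y ∈ G, ⁅x, y⁆ ∈ H}
  add_mem' := by
    intro a b ha hb y hy
    rw [add_lie]; exact H.add_mem (ha y hy) (hb y hy)
  zero_mem' := by intro y _; simp
  smul_mem' := by
    intro t a ha y hy
    rw [smul_lie]; exact H.smul_mem _ (ha y hy)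

lemma exists_adapted [FiniteDimensional ℝ g] {n : ℕ} (hn : 5 ≤ n) (h : IsFiliform ℝ g n) :
    ∃ G : ℕ → Submodule ℝ g, ∃ D X, Adapted n G D X := by
  let G : ℕ → Submodule ℝ g := fun a => lcs ℝ g (a-1)
  have Gtop : G 1 = ⊤ := rfl
  have Ganti : ∀ a b, a ≤ b → G b ≤ G a := fun a b hab => lcs_anti (by omega)
  have Gbot : ∀ m, n ≤ m → G m = ⊥ := fun m hm => by
    rw [eq_bot_iff, ← h.2.2]; exact lcs_anti (by omega)
  have Glie : ∀ a b, 1 ≤ a → 1 ≤ b → ∀ x ∈ G a, ∀ y ∈ G b, ⁅x, y⁆ ∈ G (a+b) := by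
    intro a b ha hb x hx y hy
    have := lcs_lie_lcs (a-1) (b-1) x y hx hy
    rwa [show a - 1 + (b-1) + 1 = a + b - 1 by omega] at this
  have Glie1 : ∀ b, 1 ≤ b → ∀ x : g, ∀ y ∈ G b, ⁅x, y⁆ ∈ G (b+1) := by
    intro b hb x y hy
    rw [add_comm]
    exact Glie 1 b le_rfl hb x (by rw [Gtop]; trivial) y hy
  have Gdim : ∀ a, 2 ≤ a → a ≤ n → finrank ℝ (G a) + a = n := by
    intro a ha ha'
    have := fil_finrank (by omega) h (a-1) (by omega) (by omega)
    show finrank ℝ (lcs ℝ g (a-1)) + a = n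
    omega
  have Gstrict : ∀ a, 1 ≤ a → a < n → ¬ G a ≤ G (a+1) := by
    intro a ha ha' hle
    have := lcs_strict (by omega) h (a-1) (by omega)
    rw [show a - 1 + 1 = a + 1 - 1 by omega] at this
    exact not_le_of_gt this hle
  have Gline : ∀ a, 2 ≤ a → a < n → ∀ x ∈ G a, x ∉ G (a+1) → ∀ y ∈ G a, ∃ t : ℝ, y - t • x ∈ G (a+1) := by
    intro a ha ha' x hx hx' y hy
    refine line_lemma (Ganti _ _ (by omega)) ?_ hx hx' hy
    have := Gdim a ha (by omega)
    have := Gdim (a+1) (by omega) (by omega)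
    omega
  obtain ⟨D, hD⟩ := Submodule.exists_forall_notMem_of_forall_ne_top
    (fun i : Fin (n-2) => ell (G (i+1)) (G (i+3))) (by
      intro i hi
      refine Gstrict (i+2) (by omega) (by omega) ?_
      refine lcs_succ_le (m := i) (fun x y hy => ?_)
      have : x ∈ ell (G (i+1)) (G (i+3)) := by rw [hi]; trivial
      exact this y hy)
  have hD' : ∀ a, 1 ≤ a → a + 2 ≤ n → ∃ y ∈ G a, ⁅D, y⁆ ∉ G (a+2) := by
    intro a ha ha'
    have := hD ⟨a-1, by omega⟩
    by_contra hc
    push Not at hc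
    apply this
    simp only [show a - 1 + 1 = a by omega, show a - 1 + 3 = a + 2 by omega]
    exact hc
  have hD2 : D ∉ G 2 := by
    intro hh
    obtain ⟨y, hy, hy'⟩ := hD' 1 le_rfl (by omega)
    exact hy' (Glie 2 1 (by omega) le_rfl D hh y hy)
  let H : Submodule ℝ g := Submodule.span ℝ {D} ⊔ G 2
  have hDH : D ∈ H := Submodule.mem_sup_left (Submodule.mem_span_singleton_self D)
  have hH1 : finrank ℝ H + 1 ≤ n := by
    have h1 := Submodule.finrank_add_le_finrank_add_finrank (Submodule.span ℝ {D}) (G 2)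
    have h2 := Gdim 2 le_rfl (by omega)
    have h3 : finrank ℝ (Submodule.span ℝ {D}) ≤ 1 := by
      simpa using finrank_span_le_card (R := ℝ) ({D} : Set g)
    change finrank ℝ (Submodule.span ℝ {D} ⊔ G 2 : Submodule ℝ g) + 1 ≤ n
    omega
  have hH2 : n ≤ finrank ℝ H + 1 := by
    have h2 := Gdim 2 le_rfl (by omega)
    have hlt : G 2 < H := by
      refine lt_of_le_of_ne le_sup_right (fun he => hD2 ?_)
      rw [he]; exact hDH
    have := Submodule.finrank_lt_finrank_of_lt hlt
    omega
  obtain ⟨y, hy⟩ : ∃ y, y ∉ H := by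
    by_contra hc
    push Not at hc
    have : H = ⊤ := by rw [eq_top_iff]; intro z _; exact hc z
    rw [this, finrank_top, h.1] at hH1
    omega
  obtain ⟨w, hw, hw'⟩ := hD' 2 (by omega) (by omega)
  obtain ⟨t, ht⟩ := Gline 3 (by omega) (by omega) ⁅D, w⁆ (Glie1 2 (by omega) D w hw) hw' ⁅y, w⁆
    (Glie1 2 (by omega) y w hw)
  let X1 : g := y - t • D
  have hX1w : ⁅X1, w⁆ ∈ G 4 := by
    show ⁅y - t • D, w⁆ ∈ G 4
    rw [sub_lie, smul_lie]; exact ht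
  have hX1H : X1 ∉ H := by
    intro hc
    apply hy
    have := H.add_mem hc (H.smul_mem t hDH)
    simpa [X1] using this
  have hw3 : w ∉ G 3 := fun hc => hw' (Glie1 3 (by omega) D w hc)
  let X : ℕ → g := fun a => ((fun z => ⁅D, z⁆)^[a-1]) X1
  have hX1 : X 1 = X1 := rfl
  have hstep : ∀ a, 1 ≤ a → ⁅D, X a⁆ = X (a+1) := by
    intro a ha
    obtain ⟨b, rfl⟩ := Nat.exists_eq_add_of_le' ha
    show _ = ((fun z => ⁅D, z⁆)^[b+1]) X1
    rw [Function.iterate_succ_apply']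
    rfl
  have hmem : ∀ a, 1 ≤ a → X a ∈ G a := by
    intro a ha
    induction a, ha using Nat.le_induction with
    | base => rw [Gtop]; trivial
    | succ a ha ih => rw [← hstep a ha]; exact Glie1 a ha D _ ih
  have hline1 : ∀ y, ∃ s t : ℝ, y - s • D - t • X 1 ∈ G 2 := by
    intro y
    obtain ⟨t, ht⟩ := line_lemma (V := ⊤) (W := H) le_top (by rw [finrank_top, h.1]; exact hH2)
      (x := X1) trivial hX1H (y := y) trivial
    obtain ⟨a, ha, b, hb, e⟩ := Submodule.mem_sup.1 ht
    obtain ⟨s, rfl⟩ := Submodule.mem_span_singleton.1 ha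
    refine ⟨s, t, ?_⟩
    rw [hX1]
    have : y - s • D - t • X1 = b := by
      rw [sub_right_comm, ← e]; simp
    rwa [this]
  have hnmem : ∀ a, 1 ≤ a → a < n → X a ∉ G (a+1) := by
    intro a ha
    induction a, ha using Nat.le_induction with
    | base => intro _ hc; exact hX1H (Submodule.mem_sup_right hc)
    | succ a ha ih =>
      intro han hc
      obtain ⟨y, hy, hy'⟩ := hD' a ha (by omega)
      apply hy'
      rcases Nat.lt_or_ge 1 a with ha1 | ha1
      · obtain ⟨t, ht⟩ := Gline a ha1 (by omega) (X a) (hmem a ha) (ih (by omega)) y hy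
        have h1 := Glie1 (a+1) (by omega) D _ ht
        rw [lie_sub, lie_smul, hstep a ha] at h1
        have := (G (a+2)).add_mem h1 ((G (a+2)).smul_mem t hc)
        simpa using this
      · have : a = 1 := by omega
        subst this
        obtain ⟨s, t, ht⟩ := hline1 y
        have h1 := Glie1 2 (by omega) D _ ht
        rw [lie_sub, lie_sub, lie_smul, lie_smul, hstep 1 ha, lie_self] at h1
        have := (G 3).add_mem h1 ((G 3).smul_mem t hc)
        simpa using this
  refine ⟨G, D, X, Gtop, Ganti, Gbot, Glie, hmem, hnmem, ?_, hline1, hstep, ?_, ?_⟩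
  · intro a ha y hy
    rcases Nat.lt_or_ge a n with han | han
    · exact Gline a ha han _ (hmem a (by omega)) (hnmem a (by omega) han) y hy
    · refine ⟨0, ?_⟩
      rw [Gbot a han] at hy
      rw [(Submodule.mem_bot ℝ).1 hy]; simp
  · obtain ⟨s, hs⟩ := Gline 2 le_rfl (by omega) w hw hw3 (X 2) (hmem 2 (by omega))
    have h1 := Glie1 3 (by omega) X1 _ hs
    rw [lie_sub, lie_smul] at h1
    have := (G 4).add_mem h1 ((G 4).smul_mem s hX1w)
    rw [hX1]
    simpa using this
  · intro b hb
    obtain ⟨b, rfl⟩ := Nat.exists_eq_add_of_le' hb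
    rfl

end


section
variable {g : Type*} [LieRing g] [LieAlgebra ℝ g]

lemma smul_mem_zero {W : Submodule ℝ g} {x : g} (hx : x ∉ W) {t : ℝ} (h : t • x ∈ W) : t = 0 := by
  by_contra ht
  exact hx ((Submodule.smul_mem_iff W ht).1 h)

lemma gr_key {G : ℕ → Submodule ℝ g} {X : ℕ → g} {β : ℕ → ℕ → ℝ}
    (lie : ∀ a b, 1 ≤ a → 1 ≤ b → ∀ x ∈ G a, ∀ y ∈ G b, ⁅x, y⁆ ∈ G (a+b))
    (mem : ∀ a, 1 ≤ a → X a ∈ G a)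
    (hβ : ∀ a b, 1 ≤ a → 1 ≤ b → ⁅X a, X b⁆ - β a b • X (a+b) ∈ G (a+b+1))
    (a b l m : ℕ) (ha : 1 ≤ a) (hb : 1 ≤ b) (hl : 1 ≤ l) (hm : a + b + l = m) :
    ⁅⁅X a, X b⁆, X l⁆ - (β a b * β (a+b) l) • X m ∈ G (m+1) := by
  subst hm
  have h1 := lie (a+b+1) l (by omega) hl _ (hβ a b ha hb) _ (mem l hl)
  have h2 := (G (a+b+l+1)).smul_mem (β a b) (hβ (a+b) l (by omega) hl)
  rw [show a+b+1+l = a+b+l+1 by ring] at h1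
  have := (G (a+b+l+1)).add_mem h1 h2
  rw [sub_lie, smul_lie, smul_sub, smul_smul] at this
  simpa using this

lemma gr_jac {G : ℕ → Submodule ℝ g} {X : ℕ → g} {β : ℕ → ℕ → ℝ}
    (lie : ∀ a b, 1 ≤ a → 1 ≤ b → ∀ x ∈ G a, ∀ y ∈ G b, ⁅x, y⁆ ∈ G (a+b))
    (mem : ∀ a, 1 ≤ a → X a ∈ G a)
    (hβ : ∀ a b, 1 ≤ a → 1 ≤ b → ⁅X a, X b⁆ - β a b • X (a+b) ∈ G (a+b+1))
    (a b l : ℕ) (ha : 1 ≤ a) (hb : 1 ≤ b) (hl : 1 ≤ l) (hn : X (a+b+l) ∉ G (a+b+l+1)) :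
    β a b * β (a+b) l + β b l * β (b+l) a + β l a * β (l+a) b = 0 := by
  apply smul_mem_zero hn
  have h1 := gr_key lie mem hβ a b l (a+b+l) ha hb hl rfl
  have h2 := gr_key lie mem hβ b l a (a+b+l) hb hl ha (by ring)
  have h3 := gr_key lie mem hβ l a b (a+b+l) hl ha hb (by ring)
  have h4 := (G (a+b+l+1)).neg_mem ((G (a+b+l+1)).add_mem ((G (a+b+l+1)).add_mem h1 h2) h3)
  have e := lie_jacobi (X a) (X b) (X l)
  rw [← lie_skew (X a) ⁅X b, X l⁆, ← lie_skew (X b) ⁅X l, X a⁆, ← lie_skew (X l) ⁅X a, X b⁆] at e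
  convert h4 using 1
  rw [← sub_eq_zero, ← neg_eq_zero, ← e]
  module

lemma gr_anti {G : ℕ → Submodule ℝ g} {X : ℕ → g} {β : ℕ → ℕ → ℝ}
    (hβ : ∀ a b, 1 ≤ a → 1 ≤ b → ⁅X a, X b⁆ - β a b • X (a+b) ∈ G (a+b+1))
    (a b : ℕ) (ha : 1 ≤ a) (hb : 1 ≤ b) (hn : X (a+b) ∉ G (a+b+1)) :
    β a b = - β b a := by
  have : β a b + β b a = 0 := by
    apply smul_mem_zero hn
    have h1 := hβ a b ha hb
    have h2 := hβ b a hb ha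
    rw [add_comm b a] at h2
    have h4 := (G (a+b+1)).neg_mem ((G (a+b+1)).add_mem h1 h2)
    convert h4 using 1
    rw [← lie_skew (X a)]
    module
  linarith

lemma Adapted.lie1 {n : ℕ} {G : ℕ → Submodule ℝ g} {D X} (A : Adapted n G D X) (b : ℕ) (hb : 1 ≤ b)
    (x y : g) (hy : y ∈ G b) : ⁅x, y⁆ ∈ G (b+1) := by
  rw [add_comm]
  exact A.lie 1 b le_rfl hb x (by rw [A.top]; trivial) y hy

lemma Adapted.orth {n : ℕ} {G : ℕ → Submodule ℝ g} {D X} (A : Adapted n G D X)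
    {ω : g →ₗ[ℝ] g →ₗ[ℝ] ℝ} (hω : IsSymplecticForm ω) (b : ℕ) (hb : 1 ≤ b) :
    ∀ a, 1 ≤ a → n + 1 ≤ a + b → ∀ x ∈ G b, ∀ y ∈ G a, ω x y = 0 := by
  induction b, hb using Nat.le_induction with
  | base =>
    intro a ha hab x hx y hy
    rw [A.bot a (by omega)] at hy
    rw [(Submodule.mem_bot ℝ).1 hy]; simp
  | succ b hb ih =>
    intro a ha hab x hx z hz
    rw [A.gen b hb] at hx
    induction hx using Submodule.span_induction with
    | mem w hw =>
      obtain ⟨x, y, hy, rfl⟩ := hw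
      have h1 := hω.2.2 x y z
      have h2 : ⁅y, z⁆ = 0 := by
        have := A.lie b a hb ha y hy z hz
        rw [A.bot (b+a) (by omega)] at this
        exact (Submodule.mem_bot ℝ).1 this
      have h3 : ⁅z, x⁆ ∈ G (a+1) := by
        rw [← lie_skew]; exact (G (a+1)).neg_mem (A.lie1 a ha x z hz)
      have h4 := ih (a+1) (by omega) (by omega) y hy _ h3
      have h5 : ω ⁅z, x⁆ y = 0 := by
        have := hω.1 (⁅z, x⁆ + y)
        simp only [map_add, LinearMap.add_apply, hω.1, h4] at this
        linarith
      rw [h2, h5] at h1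
      simpa using h1
    | zero => simp
    | add a b ha hb h1 h2 => rw [map_add, LinearMap.add_apply, h1, h2, add_zero]
    | smul t a ha h1 => rw [map_smul, LinearMap.smul_apply, h1, smul_zero]

lemma symp_skew {ω : g →ₗ[ℝ] g →ₗ[ℝ] ℝ} (hω : IsSymplecticForm ω) (x y : g) : ω x y = - ω y x := by
  have := hω.1 (x + y)
  simp only [map_add, LinearMap.add_apply, hω.1] at this
  linarith

lemma stage2 {k : ℕ} (hk : 3 ≤ k) {G : ℕ → Submodule ℝ g} {D X} (A : Adapted (2*k) G D X)
    {ω : g →ₗ[ℝ] g →ₗ[ℝ] ℝ} (hω : IsSymplecticForm ω)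
    (orth : ∀ b, 1 ≤ b → ∀ a, 1 ≤ a → 2*k + 1 ≤ a + b → ∀ x ∈ G b, ∀ y ∈ G a, ω x y = 0) :
    (∀ a b, 1 ≤ a → 1 ≤ b → ⁅X a, X b⁆ ∈ G (a+b+1)) ∧
    (∀ a b, 1 ≤ a → 1 ≤ b → a + b = 2*k → ω (X a) (X b) = 0) := by
  have hex : ∀ a b, ∃ t : ℝ, 1 ≤ a → 1 ≤ b → ⁅X a, X b⁆ - t • X (a+b) ∈ G (a+b+1) := by
    intro a b
    by_cases hab : 1 ≤ a ∧ 1 ≤ b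
    · obtain ⟨t, ht⟩ := A.line (a+b) (by omega) _ (A.lie a b hab.1 hab.2 _ (A.mem a hab.1) _ (A.mem b hab.2))
      exact ⟨t, fun _ _ => ht⟩
    · exact ⟨0, fun h1 h2 => absurd ⟨h1, h2⟩ hab⟩
  choose β hβ using hex
  have hrec : Rec 1 (2*k-1) β := by
    refine ⟨fun a b ha hb hab => gr_anti hβ a b ha hb (A.nmem _ (by omega) (by omega)), ?_⟩
    intro a b ha hb hab
    have : β a b - (β (a+1) b + β a (b+1)) = 0 := by
      apply smul_mem_zero (A.nmem (a+b+1) (by omega) (by omega))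
      have h1 := A.lie1 (a+b+1) (by omega) D _ (hβ a b ha hb)
      have h2 := hβ (a+1) b (by omega) hb
      have h3 := hβ a (b+1) ha (by omega)
      rw [show a + 1 + b = a+b+1 by ring] at h2
      rw [show a + (b + 1) = a+b+1 by ring] at h3
      have h4 := (G (a+b+1+1)).sub_mem ((G (a+b+1+1)).add_mem h2 h3) h1
      convert h4 using 1
      rw [lie_sub, lie_smul, A.step (a+b) (by omega), leibniz_lie, A.step a ha, A.step b hb]
      module
    linarith
  have hjac : Jac 1 (2*k-1) β := fun a b l ha hb hl h =>
    gr_jac A.lie A.mem hβ a b l ha hb hl (A.nmem _ (by omega) (by omega))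
  have h12 : β 1 2 = 0 := by
    apply smul_mem_zero (A.nmem 3 (by omega) (by omega))
    have h1 := (G 4).sub_mem A.h12 (hβ 1 2 (by omega) (by omega))
    simpa using h1
  have hz := stage1 hrec hjac h12
  obtain ⟨B, hB⟩ := hrec.altw (2*k-1) le_rfl (fun a b ha hb hab => hz a b ha hb (by omega))
  have htop : ∀ a b, 1 ≤ a → 1 ≤ b → a + b = 2*k-1 → ⁅X a, X b⁆ = ((-1)^a * B) • X (2*k-1) := by
    intro a b ha hb hab
    have := hβ a b ha hb
    rw [A.bot (a+b+1) (by omega), hB a b ha hb hab, hab] at this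
    exact sub_eq_zero.1 ((Submodule.mem_bot ℝ).1 this)
  have hlow : ∀ a b, 1 ≤ a → 1 ≤ b → a + b ≤ 2*k-2 → ⁅X a, X b⁆ ∈ G (a+b+1) := by
    intro a b ha hb hab
    have := hβ a b ha hb
    rwa [hz a b ha hb (by omega), zero_smul, sub_zero] at this
  have hσ : ∀ a b, 1 ≤ a → 1 ≤ b → a + b = 2*k-1 →
      ω (X (a+1)) (X b) + (-1)^a * B * ω (X (2*k-1)) D + ω (X a) (X (b+1)) = 0 := by
    intro a b ha hb hab
    have := hω.2.2 D (X a) (X b)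
    rw [A.step a ha, htop a b ha hb hab, ← lie_skew, A.step b hb, map_smul, LinearMap.smul_apply,
      map_neg, LinearMap.neg_apply, symp_skew hω (X (b+1))] at this
    simpa using this
  have hτ : B ≠ 0 → ω (X (2*k-1)) (X 1) = 0 := by
    intro hB0
    have := hω.2.2 (X 2) (X (2*k-3)) (X 1)
    rw [htop 2 (2*k-3) (by omega) (by omega) (by omega)] at this
    have e1 : ω ⁅X (2*k-3), X 1⁆ (X 2) = 0 := by
      refine orth (2*k-3+1+1) (by omega) 2 (by omega) (by omega) _ ?_ _ (A.mem 2 (by omega))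
      exact hlow _ _ (by omega) (by omega) (by omega)
    have e2 : ω ⁅X 1, X 2⁆ (X (2*k-3)) = 0 := by
      refine orth 4 (by omega) (2*k-3) (by omega) (by omega) _ A.h12 _ (A.mem _ (by omega))
    rw [e1, e2, map_smul, LinearMap.smul_apply] at this
    simpa [hB0] using this
  have hB0 : B = 0 := by
    by_contra hB0
    have h1 := hτ hB0
    -- the sequence
    have hs : ∀ a, 1 ≤ a → a ≤ 2*k-1 →
        ω (X a) (X (2*k-a)) = (-1)^a * ((a - 1) * (B * ω (X (2*k-1)) D)) := by
      intro a ha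
      induction a, ha using Nat.le_induction with
      | base => intro _; rw [symp_skew hω, h1]; simp
      | succ a ha ih =>
        intro ha'
        have h2 := ih (by omega)
        have h3 := hσ a (2*k-1-a) ha (by omega) (by omega)
        rw [show 2*k-1-a+1 = 2*k-a by omega, h2] at h3
        rw [show 2*k-(a+1) = 2*k-1-a by omega]
        push_cast
        rw [pow_succ]
        linarith
    have h2 := hs k (by omega) (by omega)
    rw [show 2*k-k = k by omega, hω.1] at h2
    have h3 := neg_one_pow_mul_eq_zero h2.symm
    have hk1 : (k:ℝ) - 1 ≠ 0 := by
      have : (3:ℝ) ≤ k := by exact_mod_cast hk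
      intro hh; linarith
    have h4 : ω (X (2*k-1)) D = 0 := by simpa [hk1, hB0] using h3
    have h5 : X (2*k-1) = 0 := by
      apply hω.2.1
      intro y
      obtain ⟨s, t, hy⟩ := A.line1 y
      have := orth (2*k-1) (by omega) 2 (by omega) (by omega) _ (A.mem _ (by omega)) _ hy
      simpa [h4, h1] using this
    apply A.nmem (2*k-1) (by omega) (by omega)
    rw [h5]; simp
  refine ⟨?_, ?_⟩
  · intro a b ha hb
    rcases Nat.lt_or_ge (a+b) (2*k-1) with h | h
    · exact hlow a b ha hb (by omega)
    · rcases Nat.lt_or_ge (a+b) (2*k) with h' | h'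
      · rw [htop a b ha hb (by omega), hB0]; simp
      · have := A.lie a b ha hb _ (A.mem a ha) _ (A.mem b hb)
        rw [A.bot _ h'] at this
        rw [(Submodule.mem_bot ℝ).1 this]; simp
  · have := alt0 (fun a => ω (X a) (X (2*k-a))) 1 (2*k-1) (by
      intro a ha ha'
      have h3 := hσ a (2*k-1-a) ha (by omega) (by omega)
      rw [show 2*k-1-a+1 = 2*k-a by omega, hB0] at h3
      beta_reduce
      rw [show 2*k-(a+1) = 2*k-1-a by omega]
      linarith) k (by omega) (by omega) (by
        beta_reduce
        rw [show 2*k-k = k by omega, hω.1])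
    intro a b ha hb hab
    have h1 := this a ha (by omega)
    beta_reduce at h1
    rwa [show 2*k-a = b by omega] at h1

structure Filt (n : ℕ) (F : ℕ → Submodule ℝ g) (E : ℕ → g) (ω : g →ₗ[ℝ] g →ₗ[ℝ] ℝ) : Prop where
  top : F 1 = ⊤
  anti : ∀ a b, 1 ≤ a → a ≤ b → F b ≤ F a
  bot : ∀ m, n < m → F m = ⊥
  line : ∀ i, 1 ≤ i → ∀ y ∈ F i, ∃ t : ℝ, y - t • E i ∈ F (i+1)
  mem : ∀ i, 1 ≤ i → E i ∈ F i
  nmem : ∀ i, 3 ≤ i → i ≤ n → E i ∉ F (i+1)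
  lie : ∀ a b, 1 ≤ a → 1 ≤ b → ∀ x ∈ F a, ∀ y ∈ F b, ⁅x, y⁆ ∈ F (a+b)
  step : ∀ i, 2 ≤ i → ⁅E 1, E i⁆ = E (i+1)
  orth : ∀ i j, 1 ≤ i → 1 ≤ j → n + 2 ≤ i + j → ∀ x ∈ F i, ∀ y ∈ F j, ω x y = 0
  zero : E 0 = 0

lemma exists_filt {k : ℕ} (hk : 3 ≤ k) {G : ℕ → Submodule ℝ g} {D X} (A : Adapted (2*k) G D X)
    {ω : g →ₗ[ℝ] g →ₗ[ℝ] ℝ} (hω : IsSymplecticForm ω)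
    (orth : ∀ b, 1 ≤ b → ∀ a, 1 ≤ a → 2*k + 1 ≤ a + b → ∀ x ∈ G b, ∀ y ∈ G a, ω x y = 0) :
    ∃ F E, Filt (2*k) F E ω := by
  obtain ⟨hXX, hσ⟩ := stage2 hk A hω orth
  let F : ℕ → Submodule ℝ g := fun i => if i ≤ 1 then ⊤ else if i = 2 then Submodule.span ℝ {X 1} ⊔ G 2 else G (i-1)
  let E : ℕ → g := fun i => if i = 0 then 0 else if i = 1 then D else X (i-1)
  have F1 : F 1 = ⊤ := by simp [F]
  have F2 : F 2 = Submodule.span ℝ {X 1} ⊔ G 2 := by simp [F]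
  have F3 : ∀ i, 3 ≤ i → F i = G (i-1) := fun i hi => by
    simp only [F]; rw [if_neg (by omega), if_neg (by omega)]
  have E1 : E 1 = D := by simp [E]
  have E2 : ∀ i, 2 ≤ i → E i = X (i-1) := fun i hi => by
    simp only [E]; rw [if_neg (by omega), if_neg (by omega)]
  have G2 : G 2 ≤ F 2 := by rw [F2]; exact le_sup_right
  have Fbot : ∀ m, 2*k < m → F m = ⊥ := fun m hm => by
    rw [F3 m (by omega)]; exact A.bot _ (by omega)
  have Fmem : ∀ i, 1 ≤ i → E i ∈ F i := by
    intro i hi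
    rcases Nat.lt_or_ge i 3 with h | h
    · interval_cases i
      · rw [F1]; trivial
      · rw [F2, E2 2 le_rfl]; exact Submodule.mem_sup_left (Submodule.mem_span_singleton_self _)
    · rw [F3 i h, E2 i (by omega)]; exact A.mem _ (by omega)
  have Fanti1 : ∀ a, 1 ≤ a → F (a+1) ≤ F a := by
    intro a ha
    rcases Nat.lt_or_ge a 3 with h | h
    · interval_cases a
      · rw [F1]; exact le_top
      · rw [F3 3 le_rfl]; exact G2
    · rw [F3 a h, F3 (a+1) (by omega)]; exact A.anti _ _ (by omega)
  have Fanti : ∀ a b, 1 ≤ a → a ≤ b → F b ≤ F a := by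
    intro a b ha hab
    induction b, hab using Nat.le_induction with
    | base => exact le_rfl
    | succ b hb ih => exact (Fanti1 b (by omega)).trans ih
  have Fline : ∀ i, 1 ≤ i → ∀ y ∈ F i, ∃ t : ℝ, y - t • E i ∈ F (i+1) := by
    intro i hi y hy
    rcases Nat.lt_or_ge i 3 with h | h
    · interval_cases i
      · obtain ⟨s, t, h1⟩ := A.line1 y
        refine ⟨s, ?_⟩
        rw [E1]
        have h2 := (F 2).add_mem (G2 h1) ((F 2).smul_mem t (Fmem 2 (by omega)))
        rw [E2 2 le_rfl] at h2
        simpa using h2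
      · rw [F2] at hy
        obtain ⟨a, ha, b, hb, e⟩ := Submodule.mem_sup.1 hy
        obtain ⟨s, rfl⟩ := Submodule.mem_span_singleton.1 ha
        refine ⟨s, ?_⟩
        rw [F3 3 le_rfl, E2 2 le_rfl, ← e]
        simpa using hb
    · rw [F3 i h] at hy
      rw [F3 (i+1) (by omega), E2 i (by omega)]
      have := A.line (i-1) (by omega) y hy
      rwa [show i - 1 + 1 = i + 1 - 1 by omega] at this
  have lieF1 : ∀ b, 1 ≤ b → ∀ x : g, ∀ y ∈ F b, ⁅x, y⁆ ∈ F (b+1) := by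
    intro b hb x y hy
    rcases Nat.lt_or_ge b 3 with h | h
    · have h1 : ⁅x, y⁆ ∈ F 3 := by
        rw [F3 3 le_rfl]
        exact A.lie1 1 le_rfl x y (by rw [A.top]; trivial)
      exact Fanti _ 3 (by omega) (by omega) h1
    · rw [F3 b h] at hy
      rw [F3 (b+1) (by omega)]
      have := A.lie1 (b-1) (by omega) x y hy
      rwa [show b - 1 + 1 = b + 1 - 1 by omega] at this
  have lieF : ∀ a b, 1 ≤ a → 1 ≤ b → ∀ x ∈ F a, ∀ y ∈ F b, ⁅x, y⁆ ∈ F (a+b) := by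
    intro a b ha hb x hx y hy
    rcases Nat.lt_or_ge a 2 with h | h
    · have : a = 1 := by omega
      subst this; rw [add_comm]; exact lieF1 b hb x y hy
    rcases Nat.lt_or_ge b 2 with h' | h'
    · have : b = 1 := by omega
      subst this; rw [← lie_skew]; exact (F (a+1)).neg_mem (lieF1 a ha y x hx)
    obtain ⟨t, ht⟩ := Fline a ha x hx
    obtain ⟨s, hs⟩ := Fline b hb y hy
    rw [F3 _ (by omega), E2 _ (by omega)] at ht hs
    rw [F3 _ (by omega)]
    have p1 := hXX (a-1) (b-1) (by omega) (by omega)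
    have p2 := A.lie (a-1) (b+1-1) (by omega) (by omega) _ (A.mem (a-1) (by omega)) _ hs
    have p3 := A.lie (a+1-1) (b-1) (by omega) (by omega) _ ht _ (A.mem (b-1) (by omega))
    have p4 := A.lie (a+1-1) (b+1-1) (by omega) (by omega) _ ht _ hs
    rw [show a - 1 + (b-1) + 1 = a+b-1 by omega] at p1
    rw [show a - 1 + (b+1-1) = a+b-1 by omega] at p2
    rw [show a + 1 - 1 + (b-1) = a+b-1 by omega] at p3
    have p4 := A.anti (a+b-1) _ (by omega) p4
    have e : ⁅x, y⁆ = (t * s) • ⁅X (a-1), X (b-1)⁆ + t • ⁅X (a-1), y - s • X (b-1)⁆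
        + s • ⁅x - t • X (a-1), X (b-1)⁆ + ⁅x - t • X (a-1), y - s • X (b-1)⁆ := by
      simp only [lie_sub, sub_lie, lie_smul, smul_lie]
      module
    rw [e]
    exact Submodule.add_mem _ (Submodule.add_mem _ (Submodule.add_mem _ (Submodule.smul_mem _ _ p1)
      (Submodule.smul_mem _ _ p2)) (Submodule.smul_mem _ _ p3)) p4
  have orth3 : ∀ i j, 1 ≤ i → 1 ≤ j → 2*k + 3 ≤ i + j → ∀ x ∈ F i, ∀ y ∈ F j, ω x y = 0 := by
    intro i j hi hj hij x hx y hy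
    rcases Nat.lt_or_ge i 3 with h | h
    · rw [Fbot j (by omega)] at hy
      rw [(Submodule.mem_bot ℝ).1 hy]; simp
    rcases Nat.lt_or_ge j 3 with h' | h'
    · rw [Fbot i (by omega)] at hx
      rw [(Submodule.mem_bot ℝ).1 hx]; simp
    rw [F3 _ h] at hx
    rw [F3 _ h'] at hy
    exact orth (i-1) (by omega) (j-1) (by omega) (by omega) x hx y hy
  refine ⟨F, E, F1, Fanti, Fbot, Fline, Fmem, ?_, lieF, ?_, ?_, by simp [E]⟩
  · intro i hi hi'
    rw [E2 i (by omega), F3 (i+1) (by omega)]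
    have := A.nmem (i-1) (by omega) (by omega)
    rwa [show i - 1 + 1 = i + 1 - 1 by omega] at this
  · intro i hi
    rw [E1, E2 i hi, E2 (i+1) (by omega), A.step _ (by omega)]
    congr 1; omega
  · intro i j hi hj hij x hx y hy
    rcases Nat.lt_or_ge (2*k+2) (i+j) with h | h
    · exact orth3 i j hi hj (by omega) x hx y hy
    rcases Nat.lt_or_ge i 2 with h2 | h2
    · rw [Fbot j (by omega)] at hy
      rw [(Submodule.mem_bot ℝ).1 hy]; simp
    rcases Nat.lt_or_ge j 2 with h2' | h2'
    · rw [Fbot i (by omega)] at hx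
      rw [(Submodule.mem_bot ℝ).1 hx]; simp
    obtain ⟨t, ht⟩ := Fline i hi x hx
    obtain ⟨s, hs⟩ := Fline j hj y hy
    have q1 := orth3 (i+1) j (by omega) hj (by omega) _ ht y hy
    have q2 := orth3 i (j+1) (by omega) (by omega) (by omega) _ (Fmem i hi) _ hs
    have q3 : ω (E i) (E j) = 0 := by
      rw [E2 i h2, E2 j h2']
      exact hσ _ _ (by omega) (by omega) (by omega)
    simp only [map_sub, LinearMap.sub_apply, map_smul, LinearMap.smul_apply, q3, smul_eq_mul] at q1 q2
    have : ω (E i) y = 0 := by linarith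
    rw [this] at q1
    linarith

end


section
variable {g : Type*} [LieRing g] [LieAlgebra ℝ g]

lemma span_le_of_line {n : ℕ} {F : ℕ → Submodule ℝ g} {E : ℕ → g}
    (bot : ∀ m, n < m → F m = ⊥)
    (line : ∀ i, 1 ≤ i → ∀ y ∈ F i, ∃ t : ℝ, y - t • E i ∈ F (i+1)) (i : ℕ) (hi : 1 ≤ i) :
    F i ≤ Submodule.span ℝ (E '' Set.Icc i n) := by
  obtain ⟨d, hd⟩ : ∃ d, n + 1 - i = d := ⟨_, rfl⟩
  induction d generalizing i with
  | zero => rw [bot i (by omega)]; exact bot_le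
  | succ d ih =>
    intro y hy
    obtain ⟨t, ht⟩ := line i hi y hy
    have h1 := ih (i+1) (by omega) (by omega) ht
    have h2 : Submodule.span ℝ (E '' Set.Icc (i+1) n) ≤ Submodule.span ℝ (E '' Set.Icc i n) :=
      Submodule.span_mono (Set.image_mono (Set.Icc_subset_Icc_left (by omega)))
    have h3 : E i ∈ Submodule.span ℝ (E '' Set.Icc i n) :=
      Submodule.subset_span ⟨i, ⟨le_rfl, by omega⟩, rfl⟩
    have := Submodule.add_mem _ (h2 h1) (Submodule.smul_mem _ t h3)
    simpa using this

lemma basis_of_line {n : ℕ} {F : ℕ → Submodule ℝ g} {E : ℕ → g} (hn : finrank ℝ g = n)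
    (top : F 1 = ⊤) (bot : ∀ m, n < m → F m = ⊥)
    (line : ∀ i, 1 ≤ i → ∀ y ∈ F i, ∃ t : ℝ, y - t • E i ∈ F (i+1)) :
    ∃ b : Basis (Fin n) ℝ g, ∀ i : Fin n, E ((i : ℕ) + 1) = b i := by
  have h := span_le_of_line bot line 1 le_rfl
  have hr : E '' Set.Icc 1 n ⊆ Set.range (fun i : Fin n => E ((i:ℕ)+1)) := by
    rintro _ ⟨i, ⟨h1, h2⟩, rfl⟩
    exact ⟨⟨i-1, by omega⟩, by simp only [show i - 1 + 1 = i by omega]⟩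
  have ht : ⊤ ≤ Submodule.span ℝ (Set.range (fun i : Fin n => E ((i:ℕ)+1))) := by
    rw [← top]; exact h.trans (Submodule.span_mono hr)
  refine ⟨basisOfTopLeSpanOfCardEqFinrank _ ht (by rw [hn]; simp), fun i => ?_⟩
  rw [coe_basisOfTopLeSpanOfCardEqFinrank]

lemma Filt.finrank_ge [FiniteDimensional ℝ g] {n : ℕ} {F : ℕ → Submodule ℝ g} {E ω} (A : Filt n F E ω)
    (hn : finrank ℝ g = n) (i : ℕ) (hi : 1 ≤ i) : n + 1 ≤ finrank ℝ (F i) + i := by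
  induction i, hi using Nat.le_induction with
  | base => rw [A.top, finrank_top, hn]
  | succ i hi ih =>
    have hle : F i ≤ Submodule.span ℝ {E i} ⊔ F (i+1) := by
      intro y hy
      obtain ⟨t, ht⟩ := A.line i hi y hy
      exact Submodule.mem_sup.2 ⟨t • E i, Submodule.smul_mem _ _ (Submodule.mem_span_singleton_self _), _, ht, by simp⟩
    have h1 := Submodule.finrank_mono hle
    have h2 := Submodule.finrank_add_le_finrank_add_finrank (Submodule.span ℝ {E i}) (F (i+1))
    have h3 : finrank ℝ (Submodule.span ℝ {E i}) ≤ 1 := by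
      simpa using finrank_span_le_card (R := ℝ) ({E i} : Set g)
    omega

lemma Filt.nondeg [FiniteDimensional ℝ g] {n : ℕ} {F : ℕ → Submodule ℝ g} {E ω} (A : Filt n F E ω)
    (hn : finrank ℝ g = n) (hω : IsSymplecticForm ω) (i j : ℕ) (hi : 1 ≤ i) (hj : 1 ≤ j)
    (hij : i + j = n + 1) : ω (E i) (E j) ≠ 0 := by
  intro h0
  have hle : F j ≤ LinearMap.BilinForm.orthogonal ω (F i) := by
    intro y hy
    rw [LinearMap.BilinForm.mem_orthogonal_iff]
    intro x hx
    obtain ⟨t, ht⟩ := A.line i hi x hx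
    obtain ⟨s, hs⟩ := A.line j hj y hy
    have q1 := A.orth (i+1) j (by omega) hj (by omega) _ ht y hy
    have q2 := A.orth i (j+1) (by omega) (by omega) (by omega) _ (A.mem i hi) _ hs
    simp only [map_sub, LinearMap.sub_apply, map_smul, LinearMap.smul_apply, h0, smul_eq_mul] at q1 q2
    have : ω (E i) y = 0 := by linarith
    rw [this] at q1
    linarith
  have hnd : LinearMap.BilinForm.Nondegenerate ω := by
    refine ⟨hω.2.1, fun y hy => hω.2.1 y (fun x => ?_)⟩
    rw [symp_skew hω, hy x, neg_zero]
  have h1 := Submodule.finrank_mono hle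
  rw [LinearMap.BilinForm.finrank_orthogonal hnd, hn] at h1
  have h2 := A.finrank_ge hn i hi
  have h3 := A.finrank_ge hn j hj
  omega

lemma Filt.consts [FiniteDimensional ℝ g] {n : ℕ} (h3 : 3 ≤ n) {F : ℕ → Submodule ℝ g} {E ω} (A : Filt n F E ω)
    (hn : finrank ℝ g = n) (hω : IsSymplecticForm ω) :
    ∃ c : ℕ → ℕ → ℝ, (∀ i j, 1 ≤ i → 1 ≤ j → i + j ≤ n → ⁅E i, E j⁆ - c i j • E (i+j) ∈ F (i+j+1)) ∧
      Rec 2 (n+1) c ∧ Jac 2 (n+1) c ∧ (∀ i, 2 ≤ i → i ≤ n → c 1 i = 1) ∧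
      (∀ i j, 1 ≤ i → 1 ≤ j → i + j = n + 1 → c i j ≠ 0) := by
  have hex : ∀ a b, ∃ t : ℝ, 1 ≤ a → 1 ≤ b → ⁅E a, E b⁆ - t • E (a+b) ∈ F (a+b+1) := by
    intro a b
    by_cases hab : 1 ≤ a ∧ 1 ≤ b
    · obtain ⟨t, ht⟩ := A.line (a+b) (by omega) _ (A.lie a b hab.1 hab.2 _ (A.mem a hab.1) _ (A.mem b hab.2))
      exact ⟨t, fun _ _ => ht⟩
    · exact ⟨0, fun h1 h2 => absurd ⟨h1, h2⟩ hab⟩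
  choose β hβ using hex
  have hτ := A.nondeg hn hω 1 n le_rfl (by omega) (by omega)
  set τ := ω (E 1) (E n) with hτd
  let c : ℕ → ℕ → ℝ := fun i j => if i + j ≤ n then β i j else ω (E i) (E j) / τ
  have clow : ∀ i j, i + j ≤ n → c i j = β i j := fun i j h => by simp only [c]; rw [if_pos h]
  have chigh : ∀ i j, i + j = n + 1 → c i j = ω (E i) (E j) / τ := fun i j h => by
    simp only [c]; rw [if_neg (by omega)]
  have canti : ∀ i j, 1 ≤ i → 1 ≤ j → 3 ≤ i + j → i + j ≤ n + 1 → c i j = - c j i := by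
    intro i j hi hj h3 h
    rcases Nat.lt_or_ge n (i+j) with h' | h'
    · rw [chigh i j (by omega), chigh j i (by omega), symp_skew hω]; ring
    · rw [clow i j h', clow j i (by omega)]
      exact gr_anti hβ i j hi hj (A.nmem _ h3 h')
  have ωkey : ∀ i j l, 1 ≤ i → 1 ≤ j → 1 ≤ l → i + j + l = n + 1 →
      c i j * c (i+j) l = ω ⁅E i, E j⁆ (E l) / τ := by
    intro i j l hi hj hl h
    rw [clow i j (by omega), chigh (i+j) l h]
    have := A.orth (i+j+1) l (by omega) hl (by omega) _ (hβ i j hi hj) _ (A.mem l hl)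
    simp only [map_sub, LinearMap.sub_apply, map_smul, LinearMap.smul_apply, smul_eq_mul] at this
    rw [sub_eq_zero.1 this]; ring
  have cjac : Jac 1 (n+1) c := by
    intro i j l hi hj hl h
    rcases Nat.lt_or_ge n (i+j+l) with h' | h'
    · rw [ωkey i j l hi hj hl (by omega), ωkey j l i hj hl hi (by omega), ωkey l i j hl hi hj (by omega),
        ← add_div, ← add_div, hω.2.2, zero_div]
    · rw [clow i j (by omega), clow (i+j) l (by omega), clow j l (by omega), clow (j+l) i (by omega),
        clow l i (by omega), clow (l+i) j (by omega)]
      exact gr_jac A.lie A.mem hβ i j l hi hj hl (A.nmem _ (by omega) h')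
  have c1 : ∀ i, 2 ≤ i → i ≤ n → c 1 i = 1 := by
    intro i hi hi'
    rcases Nat.lt_or_ge i n with h | h
    · rw [clow 1 i (by omega)]
      have h1 := hβ 1 i le_rfl (by omega)
      rw [A.step i hi, add_comm 1 i] at h1
      have : 1 - β 1 i = 0 := by
        apply smul_mem_zero (A.nmem (i+1) (by omega) (by omega))
        rw [sub_smul, one_smul]; exact h1
      linarith
    · have : i = n := by omega
      subst this
      rw [chigh 1 i (by omega)]
      exact div_self hτ
  refine ⟨c, ?_, ⟨?_, ?_⟩, ?_, c1, ?_⟩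
  · intro i j hi hj h
    rw [clow i j h]; exact hβ i j hi hj
  · intro i j hi hj h
    exact canti i j (by omega) (by omega) (by omega) h
  · intro i j hi hj h
    have := cjac 1 i j (by omega) (by omega) (by omega) (by omega)
    rw [c1 i hi (by omega), canti (i+j) 1 (by omega) (by omega) (by omega) (by omega),
      c1 (i+j) (by omega) (by omega), canti j 1 (by omega) (by omega) (by omega) (by omega),
      c1 j hj (by omega), canti (j+1) i (by omega) (by omega) (by omega) (by omega), add_comm 1 i] at this
    linarith
  · intro i j l hi hj hl h
    exact cjac i j l (by omega) (by omega) (by omega) h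
  · intro i j hi hj h
    rw [chigh i j h]
    exact div_ne_zero (A.nondeg hn hω i j hi hj h) hτ

end
theorem statement11 {g : Type*} [LieRing g] [LieAlgebra ℝ g]
    (k : ℕ) (hk : 12 ≤ 2 * k)
    (hfil : IsFiliform ℝ g (2 * k))
    (hsympl : ∃ ω : g →ₗ[ℝ] g →ₗ[ℝ] ℝ, IsSymplecticForm ω) :
    ∃ E : ℕ → g,
      (∃ b : Basis (Fin (2 * k)) ℝ g, ∀ i : Fin (2 * k), E ((i : ℕ) + 1) = b i) ∧
      (∀ m : ℕ, m = 0 ∨ 2 * k < m → E m = 0) ∧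
      (((∀ i : ℕ, 2 ≤ i → i ≤ 2 * k - 1 →
          ⁅E 1, E i⁆ - E (i + 1) ∈ Submodule.span ℝ (E '' Set.Icc (i + 2) (2 * k))) ∧
        (∀ i j : ℕ, 2 ≤ i → i < j → j ≤ 2 * k →
          ⁅E i, E j⁆ ∈ Submodule.span ℝ (E '' Set.Icc (i + j + 1) (2 * k)))) ∨
       (∀ i j : ℕ, 1 ≤ i → i < j → j ≤ 2 * k →
          ⁅E i, E j⁆ - ((j : ℝ) - (i : ℝ)) • E (i + j) ∈
            Submodule.span ℝ (E '' Set.Icc (i + j + 1) (2 * k)))) := by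
  obtain ⟨ω, hω⟩ := hsympl
  have hdim : finrank ℝ g = 2 * k := hfil.1
  haveI : FiniteDimensional ℝ g := FiniteDimensional.of_finrank_pos (by omega)
  obtain ⟨G, D, X, hA⟩ := exists_adapted (by omega) hfil
  obtain ⟨F, E, A⟩ := exists_filt (by omega) hA hω (hA.orth hω)
  obtain ⟨c, hc, hrec, hjac, hc1, hnd⟩ := A.consts (by omega) hdim hω
  have Ezero : ∀ m, 2 * k < m → E m = 0 := by
    intro m hm
    have := A.mem m (by omega)
    rw [A.bot m hm] at this
    exact (Submodule.mem_bot ℝ).1 this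
  have lie0 : ∀ i j, 1 ≤ i → 1 ≤ j → 2 * k < i + j → ⁅E i, E j⁆ = 0 := by
    intro i j hi hj h
    have := A.lie i j hi hj _ (A.mem i hi) _ (A.mem j hj)
    rw [A.bot _ h] at this
    exact (Submodule.mem_bot ℝ).1 this
  rcases combi k (by omega) c hrec hjac (hnd 2 (2*k-1) (by omega) (by omega) (by omega))
    (hnd 3 (2*k-2) (by omega) (by omega) (by omega)) with h0 | ⟨t, ht, h0⟩
  · refine ⟨E, basis_of_line hdim A.top A.bot A.line, ?_, Or.inl ⟨?_, ?_⟩⟩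
    · rintro m (rfl | hm)
      · exact A.zero
      · exact Ezero m hm
    · intro i hi _
      rw [A.step i hi, sub_self]; exact Submodule.zero_mem _
    · intro i j hi hij hj
      rcases Nat.lt_or_ge (2*k) (i+j) with h | h
      · rw [lie0 i j (by omega) (by omega) h]; exact Submodule.zero_mem _
      · apply span_le_of_line A.bot A.line (i+j+1) (by omega)
        have := hc i j (by omega) (by omega) h
        rwa [h0 i j hi (by omega) h, zero_smul, sub_zero] at this
  · let μ : ℕ → ℝ := fun i => if i ≤ 1 then 1 else 1 / (t * (i-2).factorial)
    have μ1 : μ 1 = 1 := by simp [μ]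
    have μ2 : ∀ i, 2 ≤ i → μ i = 1 / (t * (i-2).factorial) := fun i hi => by
      simp only [μ]; rw [if_neg (by omega)]
    have μ0 : ∀ i, μ i ≠ 0 := by
      intro i
      simp only [μ]
      split_ifs
      · exact one_ne_zero
      · exact one_div_ne_zero (mul_ne_zero ht (by positivity))
    have line' : ∀ i, 1 ≤ i → ∀ y ∈ F i, ∃ t : ℝ, y - t • (μ i • E i) ∈ F (i+1) := by
      intro i hi y hy
      obtain ⟨s, hs⟩ := A.line i hi y hy
      refine ⟨s / μ i, ?_⟩
      rwa [smul_smul, div_mul_cancel₀ _ (μ0 i)]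
    refine ⟨fun i => μ i • E i, basis_of_line (E := fun i => μ i • E i) hdim A.top A.bot line', ?_, Or.inr ?_⟩
    · rintro m (rfl | hm)
      · simp [A.zero]
      · simp [Ezero m hm]
    · intro i j hi hij hj
      beta_reduce
      rcases Nat.lt_or_ge (2*k) (i+j) with h | h
      · rw [smul_lie, lie_smul, lie0 i j (by omega) (by omega) h, Ezero _ h]; simp
      apply span_le_of_line (E := fun i => μ i • E i) A.bot line' (i+j+1) (by omega)
      have hm := (F (i+j+1)).smul_mem (μ i * μ j) (hc i j hi (by omega) h)
      have key : μ i * μ j * c i j = ((j:ℝ) - i) * μ (i+j) := by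
        rcases Nat.lt_or_ge 1 i with h1 | h1
        · rw [h0 i j h1 (by omega) h, μ2 i h1, μ2 j (by omega), μ2 (i+j) (by omega)]
          unfold vv
          have f1 : (((i-2).factorial : ℕ):ℝ) ≠ 0 := by positivity
          have f2 : (((j-2).factorial : ℕ):ℝ) ≠ 0 := by positivity
          have f3 : (((i+j-2).factorial : ℕ):ℝ) ≠ 0 := by positivity
          field_simp
        · have : i = 1 := by omega
          subst this
          obtain ⟨q, rfl⟩ := Nat.exists_eq_add_of_le' (show 2 ≤ j by omega)
          rw [hc1 _ (by omega) hj, μ1, μ2 _ (by omega), μ2 _ (by omega),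
            show 1 + (q + 2) - 2 = q + 1 by omega, show q + 2 - 2 = q by omega, Nat.factorial_succ]
          have f1 : ((q.factorial : ℕ):ℝ) ≠ 0 := by positivity
          push_cast
          field_simp
          ring
      rw [smul_sub, smul_smul, key] at hm
      convert hm using 1
      rw [smul_lie, lie_smul, smul_smul, smul_smul]


end Paper
end

section
/- Let K be a field of characteristic zero and k ≥ 2. (a) The alternating bilinear form ω on V_{2k} determined by ω(e_i, e_j) = (j − i) when i + j = 2k + 1 (i < j) and ω(e_i, e_j) = 0 when i + j ≠ 2k + 1 (i < j) is a symplectic structure on V_{2k}. (b) The alternating bilinear form ω' on m_0(2k) determined by ω'(e_i, e_j) = (−1)^{i+1} when i + j = 2k + 1 (i < j) and ω'(e_i, e_j) = 0 when i + j ≠ 2k + 1 (i < j) is a symplectic structure on m_0(2k). -/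
namespace Paper

open Module Submodule

variable (K : Type*) [Field K] {g : Type*} [LieRing g] [LieAlgebra K g]

section Helpers

theorem aux_ind {K : Type*} [Field K] {g : Type*} [AddCommGroup g] [Module K g]
    {n : ℕ} {E : ℕ → g} (hb : ∃ b : Basis (Fin n) K g, ∀ i : Fin n, E ((i : ℕ) + 1) = b i)
    (P : g → Prop) (hE : ∀ i : ℕ, 1 ≤ i → i ≤ n → P (E i)) (h0 : P 0)
    (hadd : ∀ x y, P x → P y → P (x + y))
    (hsmul : ∀ (a : K) x, P x → P (a • x)) (x : g) : P x := by
  obtain ⟨b, hb⟩ := hb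
  have hx : x ∈ span K (Set.range b) := b.mem_span x
  induction hx using Submodule.span_induction with
  | mem x h =>
    obtain ⟨i, rfl⟩ := h
    rw [← hb i]
    exact hE _ (by omega) (by omega)
  | zero => exact h0
  | add x y _ _ hx hy => exact hadd x y hx hy
  | smul a x _ hx => exact hsmul a x hx

theorem aux_closed {K : Type*} [Field K] {g : Type*} [LieRing g] [LieAlgebra K g]
    {n : ℕ} {E : ℕ → g} (hb : ∃ b : Basis (Fin n) K g, ∀ i : Fin n, E ((i : ℕ) + 1) = b i)
    (ω : g →ₗ[K] g →ₗ[K] K)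
    (h : ∀ i j l : ℕ, 1 ≤ i → i ≤ n → 1 ≤ j → j ≤ n → 1 ≤ l → l ≤ n →
      ω ⁅E i, E j⁆ (E l) + ω ⁅E j, E l⁆ (E i) + ω ⁅E l, E i⁆ (E j) = 0)
    (x y z : g) : ω ⁅x, y⁆ z + ω ⁅y, z⁆ x + ω ⁅z, x⁆ y = 0 := by
  revert y z
  refine aux_ind hb (fun x => ∀ y z, ω ⁅x, y⁆ z + ω ⁅y, z⁆ x + ω ⁅z, x⁆ y = 0) ?_ ?_ ?_ ?_ x
  · intro i hi hi' y
    refine aux_ind hb (fun y => ∀ z, ω ⁅E i, y⁆ z + ω ⁅y, z⁆ (E i) + ω ⁅z, E i⁆ y = 0) ?_ ?_ ?_ ?_ y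
    · intro j hj hj' z
      refine aux_ind hb (fun z => ω ⁅(E i), (E j)⁆ z + ω ⁅(E j), z⁆ (E i) + ω ⁅z, (E i)⁆ (E j) = 0) ?_ ?_ ?_ ?_ z
      · intro l hl hl'
        exact h i j l hi hi' hj hj' hl hl'
      · simp
      · intro x y hx hy
        simp only [lie_add, add_lie, map_add, LinearMap.add_apply]
        linear_combination hx + hy
      · intro a x hx
        simp only [lie_smul, smul_lie, map_smul, LinearMap.smul_apply, smul_eq_mul]
        linear_combination a * hx
    · simp
    · intro x y hx hy z
      simp only [lie_add, add_lie, map_add, LinearMap.add_apply]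
      linear_combination hx z + hy z
    · intro a x hx z
      simp only [lie_smul, smul_lie, map_smul, LinearMap.smul_apply, smul_eq_mul]
      linear_combination a * hx z
  · simp
  · intro x y hx hy z w
    simp only [lie_add, add_lie, map_add, LinearMap.add_apply]
    linear_combination hx z w + hy z w
  · intro a x hx z w
    simp only [lie_smul, smul_lie, map_smul, LinearMap.smul_apply, smul_eq_mul]
    linear_combination a * hx z w

theorem aux_nondeg {K : Type*} [Field K] {g : Type*} [AddCommGroup g] [Module K g]
    {n : ℕ} {E : ℕ → g} (hb : ∃ b : Basis (Fin n) K g, ∀ i : Fin n, E ((i : ℕ) + 1) = b i)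
    (ω : g →ₗ[K] g →ₗ[K] K) (c : ℕ → ℕ → K)
    (h : ∀ i j : ℕ, 1 ≤ i → i ≤ n → 1 ≤ j → j ≤ n →
      ω (E i) (E j) = if i + j = n + 1 then c i j else 0)
    (hc : ∀ i j : ℕ, i + j = n + 1 → c i j ≠ 0)
    (x : g) (hx : ∀ y, ω x y = 0) : x = 0 := by
  obtain ⟨b, hb⟩ := hb
  apply b.ext_elem
  intro i
  have h1 := hx (E (n - i))
  rw [← b.sum_repr x] at h1
  simp only [map_sum, map_smul, LinearMap.sum_apply, LinearMap.smul_apply, smul_eq_mul] at h1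
  rw [Finset.sum_eq_single i] at h1
  · rw [← hb, h _ _ (by omega) (by omega) (by omega) (by omega), if_pos (by omega)] at h1
    simpa [hc (i + 1) (n - i) (by omega)] using h1
  · intro j _ hj
    have : (j : ℕ) ≠ i := fun h => hj (Fin.ext h)
    rw [← hb, h _ _ (by omega) (by omega) (by omega) (by omega), if_neg (by omega), mul_zero]
  · simp

theorem aux_exists {K : Type*} [Field K] [CharZero K] {g : Type*} [AddCommGroup g] [Module K g]
    {n : ℕ} {E : ℕ → g} (hb : ∃ b : Basis (Fin n) K g, ∀ i : Fin n, E ((i : ℕ) + 1) = b i)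
    (c : ℕ → ℕ → K)
    (hc : ∀ i j : ℕ, i + j = n + 1 → c i j = - c j i) :
    ∃ ω : g →ₗ[K] g →ₗ[K] K, (∀ x : g, ω x x = 0) ∧
        ∀ i j : ℕ, 1 ≤ i → i < j → j ≤ n →
          ω (E i) (E j) = if i + j = n + 1 then c i j else 0 := by
  obtain ⟨b, hb'⟩ := hb
  let ω : g →ₗ[K] g →ₗ[K] K := b.constr K fun i => b.constr K fun j =>
    if (i + 1 + (j + 1) : ℕ) = n + 1 then c (i + 1) (j + 1) else 0
  have hω : ∀ i j : ℕ, 1 ≤ i → i ≤ n → 1 ≤ j → j ≤ n →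
      ω (E i) (E j) = if i + j = n + 1 then c i j else 0 := by
    intro i j hi hi' hj hj'
    obtain ⟨i, rfl⟩ := Nat.exists_eq_add_of_le' hi
    obtain ⟨j, rfl⟩ := Nat.exists_eq_add_of_le' hj
    have h1 := hb' ⟨i, by omega⟩
    have h2 := hb' ⟨j, by omega⟩
    simp only at h1 h2
    rw [h1, h2]
    simp only [ω, Basis.constr_basis]
  refine ⟨ω, ?_, fun i j hi hij hj => hω i j hi (by omega) (by omega) hj⟩
  have hanti : ∀ x y, ω x y + ω y x = 0 := by
    intro x
    refine aux_ind ⟨b, hb'⟩ (fun x => ∀ y, ω x y + ω y x = 0) ?_ ?_ ?_ ?_ x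
    · intro i hi hi' y
      refine aux_ind ⟨b, hb'⟩ (fun y => ω (E i) y + ω y (E i) = 0) ?_ ?_ ?_ ?_ y
      · intro j hj hj'
        rw [hω i j hi hi' hj hj', hω j i hj hj' hi hi', add_comm j i]
        split_ifs with h
        · rw [hc i j h]; ring
        · simp
      · simp
      · intro x y hx hy
        simp only [map_add, LinearMap.add_apply]
        linear_combination hx + hy
      · intro a x hx
        simp only [map_smul, LinearMap.smul_apply, smul_eq_mul]
        linear_combination a * hx
    · simp
    · intro x y hx hy z
      simp only [map_add, LinearMap.add_apply]
      linear_combination hx z + hy z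
    · intro a x hx z
      simp only [map_smul, LinearMap.smul_apply, smul_eq_mul]
      linear_combination a * hx z
  intro x
  have := hanti x x
  exact add_self_eq_zero.mp this

theorem aux_full {K : Type*} [Field K] {g : Type*} [AddCommGroup g] [Module K g]
    {k : ℕ} {E : ℕ → g} (hE0 : ∀ m : ℕ, m = 0 ∨ 2 * k < m → E m = 0)
    (ω : g →ₗ[K] g →ₗ[K] K) (halt : ∀ x, ω x x = 0) (c : ℕ → ℕ → K)
    (hc : ∀ i j : ℕ, i + j = 2 * k + 1 → c i j = - c j i)
    (h : ∀ i j : ℕ, 1 ≤ i → i < j → j ≤ 2 * k →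
          ω (E i) (E j) = if i + j = 2 * k + 1 then c i j else 0)
    (i j : ℕ) (hi : 1 ≤ i) (hj : 1 ≤ j) :
    ω (E i) (E j) = if i + j = 2 * k + 1 then c i j else 0 := by
  have hanti : ∀ x y, ω x y = - ω y x := by
    intro x y
    have := halt (x + y)
    simp only [map_add, LinearMap.add_apply, halt] at this
    linear_combination this
  by_cases hi' : 2 * k < i
  · rw [hE0 i (Or.inr hi'), if_neg (by omega)]; simp
  by_cases hj' : 2 * k < j
  · rw [hE0 j (Or.inr hj'), if_neg (by omega)]; simp
  rcases lt_trichotomy i j with hij | hij | hij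
  · exact h i j hi hij (by omega)
  · subst hij
    rw [halt, if_neg (by omega)]
  · rw [hanti, h j i hj hij (by omega), add_comm j i]
    split_ifs with hs
    · rw [hc i j hs]
    · simp

theorem aux_sign {K : Type*} [Field K] (k i j : ℕ) (h : i + j = 2 * k + 1) :
    (-1 : K) ^ (i + 1) = - (-1 : K) ^ (j + 1) := by
  rcases Nat.even_or_odd i with hi | hi
  · have hj : Odd j := by
      rcases Nat.even_or_odd j with hj | hj
      · exfalso; obtain ⟨a, rfl⟩ := hi; obtain ⟨b, rfl⟩ := hj; omega
      · exact hj
    rw [hi.add_one.neg_one_pow, hj.add_one.neg_one_pow]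
  · have hj : Even j := by
      rcases Nat.even_or_odd j with hj | hj
      · exact hj
      · exfalso; obtain ⟨a, rfl⟩ := hi; obtain ⟨b, rfl⟩ := hj; omega
    rw [hi.add_one.neg_one_pow, hj.add_one.neg_one_pow, neg_neg]

theorem aux_V {K : Type*} [Field K] [CharZero K] (k : ℕ)
    {g : Type*} [LieRing g] [LieAlgebra K g] (E : ℕ → g)
    (hV : IsVnBasis K (2 * k) E) (ω : g →ₗ[K] g →ₗ[K] K) (halt : ∀ x : g, ω x x = 0)
    (h : ∀ i j : ℕ, 1 ≤ i → i < j → j ≤ 2 * k →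
          ω (E i) (E j) = if i + j = 2 * k + 1 then (j : K) - (i : K) else 0) :
    IsSymplecticForm ω := by
  obtain ⟨hb, hE0, hbr⟩ := hV
  have hω := aux_full hE0 ω halt (fun i j => (j : K) - (i : K)) (fun i j _ => by ring) h
  have hB : ∀ i j : ℕ, 1 ≤ i → i ≤ 2 * k → 1 ≤ j → j ≤ 2 * k →
      ⁅E i, E j⁆ = ((j : K) - (i : K)) • E (i + j) := by
    intro i j hi hi' hj hj'
    rcases lt_trichotomy i j with hij | hij | hij
    · exact hbr i j hi hij hj'
    · subst hij; simp
    · rw [← lie_skew, hbr j i hj hij hi', add_comm j i, ← neg_smul, neg_sub]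
  refine ⟨halt, ?_, aux_closed hb ω ?_⟩
  · refine aux_nondeg hb ω _ (fun i j hi _ hj _ => hω i j hi hj) ?_
    intro i j hij h0
    have : j = i := by exact_mod_cast sub_eq_zero.mp h0
    omega
  · intro i j l hi hi' hj hj' hl hl'
    rw [hB i j hi hi' hj hj', hB j l hj hj' hl hl', hB l i hl hl' hi hi']
    simp only [map_smul, LinearMap.smul_apply, smul_eq_mul]
    rw [hω _ _ (by omega) hl, hω _ _ (by omega) hi, hω _ _ (by omega) hj]
    by_cases hs : i + j + l = 2 * k + 1
    · rw [if_pos hs, if_pos (by omega), if_pos (by omega)]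
      push_cast
      ring
    · rw [if_neg hs, if_neg (by omega), if_neg (by omega)]
      ring

theorem aux_M {K : Type*} [Field K] (k : ℕ) (hk : 2 ≤ k)
    {g : Type*} [LieRing g] [LieAlgebra K g] (E : ℕ → g)
    (hM : IsM0Basis K (2 * k) E) (ω : g →ₗ[K] g →ₗ[K] K) (halt : ∀ x : g, ω x x = 0)
    (h : ∀ i j : ℕ, 1 ≤ i → i < j → j ≤ 2 * k →
          ω (E i) (E j) = if i + j = 2 * k + 1 then (-1 : K) ^ (i + 1) else 0) :
    IsSymplecticForm ω := by
  obtain ⟨hb, hE0, hbr, hbn, hbz⟩ := hM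
  have hω := aux_full hE0 ω halt (fun i _ => (-1 : K) ^ (i + 1)) (fun i j => aux_sign k i j) h
  have hB1 : ∀ i : ℕ, 2 ≤ i → i ≤ 2 * k → ⁅E 1, E i⁆ = E (i + 1) := by
    intro i hi hi'
    by_cases hin : i = 2 * k
    · subst hin; rw [hbn, hE0 _ (Or.inr (by omega))]
    · exact hbr i hi (by omega)
  have hBz : ∀ i j : ℕ, 2 ≤ i → i ≤ 2 * k → 2 ≤ j → j ≤ 2 * k → ⁅E i, E j⁆ = 0 := by
    intro i j hi hi' hj hj'
    rcases lt_trichotomy i j with hij | hij | hij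
    · exact hbz i j hi hij hj'
    · subst hij; simp
    · rw [← lie_skew, hbz j i hj hij hi', neg_zero]
  have key : ∀ j l : ℕ, 1 ≤ j → j ≤ 2 * k → 1 ≤ l → l ≤ 2 * k →
      ω ⁅E 1, E j⁆ (E l) + ω ⁅E j, E l⁆ (E 1) + ω ⁅E l, E 1⁆ (E j) = 0 := by
    intro j l hj hj' hl hl'
    rcases Nat.lt_or_ge 1 j with hj1 | hj1
    · rcases Nat.lt_or_ge 1 l with hl1 | hl1
      · rw [hBz j l hj1 hj' hl1 hl', ← lie_skew (E l) (E 1), hB1 j hj1 hj', hB1 l hl1 hl']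
        simp only [map_zero, map_neg, LinearMap.zero_apply, LinearMap.neg_apply]
        rw [hω _ _ (by omega) hl, hω _ _ (by omega) hj]
        by_cases hs : j + 1 + l = 2 * k + 1
        · rw [if_pos hs, if_pos (by omega), aux_sign k (j + 1) l hs, pow_succ _ (l + 1)]
          ring
        · rw [if_neg hs, if_neg (by omega)]
          ring
      · obtain rfl : l = 1 := by omega
        have hsk := lie_skew (E j) (E 1)
        rw [← hsk]
        simp only [lie_self, map_zero, map_neg, LinearMap.zero_apply, LinearMap.neg_apply]
        ring
    · obtain rfl : j = 1 := by omega
      have hsk := lie_skew (E l) (E 1)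
      rw [← hsk]
      simp only [lie_self, map_zero, map_neg, LinearMap.zero_apply, LinearMap.neg_apply]
      ring
  refine ⟨halt, ?_, aux_closed hb ω ?_⟩
  · refine aux_nondeg hb ω _ (fun i j hi _ hj _ => hω i j hi hj) ?_
    intro i j _
    exact pow_ne_zero _ (by simp)
  · intro i j l hi hi' hj hj' hl hl'
    by_cases h1 : i = 1
    · subst h1; exact key j l hj hj' hl hl'
    by_cases h2 : j = 1
    · subst h2
      linear_combination key l i hl hl' hi hi'
    by_cases h3 : l = 1
    · subst h3
      linear_combination key i j hi hi' hj hj'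
    rw [hBz i j (by omega) hi' (by omega) hj', hBz j l (by omega) hj' (by omega) hl',
      hBz l i (by omega) hl' (by omega) hi']
    simp

end Helpers

/-- (a) the alternating bilinear form on `V_{2k}` with
`ω(e_i, e_j) = (j - i)` for `i + j = 2k + 1` (`i < j`) and `ω(e_i, e_j) = 0` otherwise is
a symplectic structure on `V_{2k}`; (b) the alternating bilinear form on `m_0(2k)` with
`ω'(e_i, e_j) = (-1)^{i+1}` for `i + j = 2k + 1` (`i < j`) and `ω'(e_i, e_j) = 0`
otherwise is a symplectic structure on `m_0(2k)`. -/
theorem statement13 {K : Type*} [Field K] [CharZero K] (k : ℕ) (hk : 2 ≤ k)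
    {g : Type*} [LieRing g] [LieAlgebra K g] (E : ℕ → g)
    (hV : IsVnBasis K (2 * k) E)
    {g' : Type*} [LieRing g'] [LieAlgebra K g'] (E' : ℕ → g')
    (hM : IsM0Basis K (2 * k) E') :
    ((∃ ω : g →ₗ[K] g →ₗ[K] K, (∀ x : g, ω x x = 0) ∧
        ∀ i j : ℕ, 1 ≤ i → i < j → j ≤ 2 * k →
          ω (E i) (E j) = if i + j = 2 * k + 1 then (j : K) - (i : K) else 0) ∧
      (∀ ω : g →ₗ[K] g →ₗ[K] K, (∀ x : g, ω x x = 0) →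
        (∀ i j : ℕ, 1 ≤ i → i < j → j ≤ 2 * k →
          ω (E i) (E j) = if i + j = 2 * k + 1 then (j : K) - (i : K) else 0) →
        IsSymplecticForm ω)) ∧
    ((∃ ω' : g' →ₗ[K] g' →ₗ[K] K, (∀ x : g', ω' x x = 0) ∧
        ∀ i j : ℕ, 1 ≤ i → i < j → j ≤ 2 * k →
          ω' (E' i) (E' j) = if i + j = 2 * k + 1 then ((-1 : K)) ^ (i + 1) else 0) ∧
      (∀ ω' : g' →ₗ[K] g' →ₗ[K] K, (∀ x : g', ω' x x = 0) →
        (∀ i j : ℕ, 1 ≤ i → i < j → j ≤ 2 * k →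
          ω' (E' i) (E' j) = if i + j = 2 * k + 1 then ((-1 : K)) ^ (i + 1) else 0) →
        IsSymplecticForm ω')) := by
  refine ⟨⟨?_, fun ω h1 h2 => aux_V k E hV ω h1 h2⟩,
    ⟨?_, fun ω h1 h2 => aux_M k hk E' hM ω h1 h2⟩⟩
  · exact aux_exists hV.1 (fun i j => (j : K) - (i : K)) (fun i j _ => by ring)
  · exact aux_exists hM.1 (fun i _ => (-1 : K) ^ (i + 1)) (fun i j => aux_sign k i j)

end Paper
end

section
/- Let g be a filiform Lie algebra of dimension n over a field K of characteristic zero whose center is spanned by a nonzero element ξ, and let c : g × g → K be an alternating bilinear 2-cocycle, i.e. c([x,y],z) + c([y,z],x) + c([z,x],y) = 0 for all x,y,z ∈ g. Let g̃ = K ⊕ g be the one-dimensional central extension of g by c, with bracket [(λ,x),(μ,y)] = (c(x,y), [x,y]). Then g̃ is a filiform Lie algebra (of dimension n+1) if and only if the linear form x ↦ c(x, ξ) on g is not identically zero. -/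
namespace Paper

open Module Submodule

/-- The lower central series of the one-dimensional central extension `g̃ = K ⊕ g` of `g`
by a 2-cocycle `c`, whose Lie bracket is `[(λ,x),(μ,y)] = (c(x,y), ⁅x,y⁆)`. -/
def lcsExt {K : Type*} [Field K] {g : Type*} [LieRing g] [LieAlgebra K g]
    (c : g →ₗ[K] g →ₗ[K] K) : ℕ → Submodule K (K × g)
  | 0 => ⊤
  | m + 1 => Submodule.span K
      {z : K × g | ∃ x : K × g, ∃ y ∈ lcsExt c m, z = (c x.2 y.2, ⁅x.2, y.2⁆)}

theorem lcsExt_snd {K : Type*} [Field K] {g : Type*} [LieRing g] [LieAlgebra K g]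
    (c : g →ₗ[K] g →ₗ[K] K) (m : ℕ) :
    (lcsExt c m).map (LinearMap.snd K K g) = lcs K g m := by
  induction m with
  | zero =>
    simp only [lcsExt, lcs, Submodule.map_top]
    exact LinearMap.range_eq_top.mpr (fun y => ⟨(0, y), rfl⟩)
  | succ m ih =>
    simp only [lcsExt, lcs]
    rw [Submodule.map_span]
    congr 1
    ext z
    constructor
    · rintro ⟨_, ⟨x, y, hy, rfl⟩, rfl⟩
      refine ⟨x.2, y.2, ?_, rfl⟩
      rw [← ih]
      exact ⟨y, hy, rfl⟩
    · rintro ⟨x, y, hy, rfl⟩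
      rw [← ih] at hy
      obtain ⟨y, hy, rfl⟩ := hy
      exact ⟨_, ⟨(0, x), y, hy, rfl⟩, rfl⟩

/-- let `g` be a filiform Lie algebra of dimension `n` (over a field of
characteristic zero) whose center is spanned by a nonzero element `ξ`, and let `c` be an
alternating 2-cocycle on `g`. Then the one-dimensional central extension `g̃ = K ⊕ g` of
`g` by `c` is a filiform Lie algebra (of dimension `n + 1`, i.e. `C^n g̃ ≠ 0` and
`C^{n+1} g̃ = 0`) if and only if the linear form `x ↦ c(x, ξ)` is not identically zero. -/
theorem statement14 {K : Type*} [Field K] [CharZero K]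
    {g : Type*} [LieRing g] [LieAlgebra K g]
    (n : ℕ) (hfil : IsFiliform K g n)
    (ξ : g) (hξ : ξ ≠ 0)
    (hcenter : {x : g | ∀ y : g, ⁅x, y⁆ = 0} = (Submodule.span K {ξ} : Submodule K g))
    (c : g →ₗ[K] g →ₗ[K] K)
    (halt : ∀ x : g, c x x = 0)
    (hcocycle : ∀ x y z : g, c ⁅x, y⁆ z + c ⁅y, z⁆ x + c ⁅z, x⁆ y = 0) :
    (Module.finrank K (K × g) = n + 1 ∧ lcsExt c (n - 1) ≠ ⊥ ∧ lcsExt c n = ⊥) ↔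
    (∃ x : g, c x ξ ≠ 0) := by
  obtain ⟨hdim, h1, h2⟩ := hfil
  have hn : 2 ≤ n := by
    by_contra h
    have : n - 2 = n - 1 := by omega
    rw [this] at h1
    exact h1 h2
  obtain ⟨k, rfl⟩ : ∃ k, n = k + 2 := ⟨n - 2, by omega⟩
  have e1 : k + 2 - 2 = k := by omega
  have e2 : k + 2 - 1 = k + 1 := by omega
  rw [e1] at h1
  rw [e2] at h2 ⊢
  have hfd : Module.Finite K g := Module.finite_of_finrank_pos (by omega)
  have hrank : Module.finrank K (K × g) = k + 2 + 1 := by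
    rw [Module.finrank_prod, hdim, Module.finrank_self]; omega
  have hbr : ∀ y ∈ lcs K g k, ∀ x : g, ⁅x, y⁆ = 0 := by
    intro y hy x
    have : ⁅x, y⁆ ∈ lcs K g (k + 1) := Submodule.subset_span ⟨x, y, hy, rfl⟩
    rw [h2] at this
    simpa using this
  have hsp : ∀ y ∈ lcs K g k, ∃ a : K, a • ξ = y := by
    intro y hy
    have : y ∈ {x : g | ∀ y : g, ⁅x, y⁆ = 0} := by
      intro x
      rw [← lie_skew, hbr y hy x, neg_zero]
    rw [hcenter] at this
    exact Submodule.mem_span_singleton.mp this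
  have hlast : lcsExt c (k + 2) = ⊥ := by
    rw [lcsExt, Submodule.span_eq_bot]
    rintro _ ⟨x, y, hy, rfl⟩
    have : y.2 ∈ lcs K g (k + 1) := by
      rw [← lcsExt_snd c]
      exact ⟨y, hy, rfl⟩
    rw [h2, Submodule.mem_bot] at this
    simp [this]
  constructor
  · rintro ⟨-, h, -⟩
    by_contra! hc
    apply h
    rw [lcsExt, Submodule.span_eq_bot]
    rintro _ ⟨x, y, hy, rfl⟩
    have hy' : y.2 ∈ lcs K g k := by
      rw [← lcsExt_snd c]
      exact ⟨y, hy, rfl⟩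
    obtain ⟨a, ha⟩ := hsp _ hy'
    rw [hbr _ hy', ← ha]
    simp [hc]
  · rintro ⟨x, hx⟩
    refine ⟨hrank, fun h => ?_, hlast⟩
    obtain ⟨y, hy, hy0⟩ := Submodule.exists_mem_ne_zero_of_ne_bot h1
    obtain ⟨a, ha⟩ := hsp y hy
    have hy' := hy
    rw [← lcsExt_snd c] at hy'
    obtain ⟨w, hw, hwy⟩ := hy'
    have hwy : w.2 = y := hwy
    have hm : (c x w.2, ⁅x, w.2⁆) ∈ lcsExt c (k + 1) :=
      Submodule.subset_span ⟨(0, x), w, hw, rfl⟩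
    rw [h, Submodule.mem_bot, hwy, ← ha] at hm
    have h0 : c x (a • ξ) = 0 := congrArg Prod.fst hm
    rw [map_smul, smul_eq_mul] at h0
    rcases mul_eq_zero.mp h0 with h0 | h0
    · apply hy0
      rw [← ha, h0, zero_smul]
    · exact hx h0

end Paper
end

section
/- Let g be a filiform Lie algebra of dimension 2k over a field K of characteristic zero and let ω be a symplectic structure on g. Then the one-dimensional central extension g̃ = K ⊕ g of g by the cocycle c = ω, with bracket [(λ,x),(μ,y)] = (ω(x,y), [x,y]), is a filiform Lie algebra of dimension 2k + 1. -/
namespace Paper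

open Module Submodule

theorem snd_mem_lcs {K : Type*} [Field K] {g : Type*} [LieRing g] [LieAlgebra K g]
    (c : g →ₗ[K] g →ₗ[K] K) (m : ℕ) : ∀ z ∈ lcsExt c m, z.2 ∈ lcs K g m := by
  induction m with
  | zero => intro z _; simp [lcs]
  | succ m ih =>
    intro z hz
    have h : lcsExt c (m + 1) ≤ (lcs K g (m + 1)).comap (LinearMap.snd K K g) := by
      rw [lcsExt, Submodule.span_le]
      rintro w ⟨x, y, hy, rfl⟩
      exact Submodule.subset_span ⟨x.2, y.2, ih y hy, rfl⟩
    exact h hz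

theorem exists_lift {K : Type*} [Field K] {g : Type*} [LieRing g] [LieAlgebra K g]
    (c : g →ₗ[K] g →ₗ[K] K) (m : ℕ) : ∀ y ∈ lcs K g m, ∃ a : K, (a, y) ∈ lcsExt c m := by
  induction m with
  | zero => intro y _; exact ⟨0, by simp [lcsExt]⟩
  | succ m ih =>
    intro z hz
    have h : lcs K g (m + 1) ≤ (lcsExt c (m + 1)).map (LinearMap.snd K K g) := by
      rw [lcs, Submodule.span_le]
      rintro w ⟨x, y, hy, rfl⟩
      obtain ⟨a, ha⟩ := ih y hy
      exact ⟨(c x y, ⁅x, y⁆), Submodule.subset_span ⟨(0, x), (a, y), ha, rfl⟩, rfl⟩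
    obtain ⟨⟨a, w⟩, hw, rfl⟩ := h hz
    exact ⟨a, hw⟩

/-- let `g` be a filiform Lie algebra of dimension `2k` over a field of
characteristic zero and `ω` a symplectic structure on `g`. Then the one-dimensional
central extension `g̃ = K ⊕ g` of `g` by the cocycle `ω` is a filiform Lie algebra of
dimension `2k + 1` (i.e. `dim g̃ = 2k + 1`, `C^{2k} g̃ ≠ 0` and `C^{2k+1} g̃ = 0`). -/
theorem statement15 {K : Type*} [Field K] [CharZero K]
    {g : Type*} [LieRing g] [LieAlgebra K g]
    (k : ℕ) (hfil : IsFiliform K g (2 * k))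
    (ω : g →ₗ[K] g →ₗ[K] K)
    (halt : ∀ x : g, ω x x = 0)
    (hnondeg : ∀ x : g, (∀ y : g, ω x y = 0) → x = 0)
    (hclosed : ∀ x y z : g, ω ⁅x, y⁆ z + ω ⁅y, z⁆ x + ω ⁅z, x⁆ y = 0) :
    Module.finrank K (K × g) = 2 * k + 1 ∧
    lcsExt ω (2 * k - 1) ≠ ⊥ ∧ lcsExt ω (2 * k) = ⊥ := by
  obtain ⟨hd, hne, hbot⟩ := hfil
  have hk : 0 < k := by
    rcases Nat.eq_zero_or_pos k with rfl | h
    · exact absurd hbot hne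
    · exact h
  have : FiniteDimensional K g := Module.finite_of_finrank_pos (by omega)
  obtain ⟨j, rfl⟩ : ∃ j, k = j + 1 := ⟨k - 1, by omega⟩
  have e1 : 2 * (j + 1) - 2 = 2 * j := by omega
  have e2 : 2 * (j + 1) - 1 = 2 * j + 1 := by omega
  have e3 : 2 * (j + 1) = 2 * j + 1 + 1 := by omega
  rw [e1] at hne
  rw [e2] at hbot
  refine ⟨?_, ?_, ?_⟩
  · rw [Module.finrank_prod, hd, Module.finrank_self]; omega
  · rw [e2]
    intro hb
    obtain ⟨y, hy, hy0⟩ := Submodule.exists_mem_ne_zero_of_ne_bot hne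
    obtain ⟨a, ha⟩ := exists_lift ω _ y hy
    apply hy0
    apply hnondeg
    intro x
    have hx : (ω x y, ⁅x, y⁆) ∈ lcsExt ω (2 * j + 1) :=
      Submodule.subset_span ⟨(0, x), (a, y), ha, rfl⟩
    rw [hb, Submodule.mem_bot, Prod.mk_eq_zero] at hx
    have h := halt (x + y)
    simp only [map_add, LinearMap.add_apply, halt, hx.1] at h
    simpa using h
  · rw [e3, lcsExt, Submodule.span_eq_bot]
    rintro z ⟨x, y, hy, rfl⟩
    have h := snd_mem_lcs ω _ y hy
    rw [hbot, Submodule.mem_bot] at h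
    simp [h]

end Paper
end

section
/- Let K be a field of characteristic zero and n ≥ 3. For every 2 ≤ k ≤ n the k-th term of the lower central series of V_n equals span(e_{k+1}, …, e_n) (in particular C^n V_n = 0 and C^{n−1} V_n = span(e_n) ≠ 0), so V_n is a filiform Lie algebra. -/
namespace Paper

open Module Submodule

variable (K : Type*) [Field K] {g : Type*} [LieRing g] [LieAlgebra K g]

theorem Vn_bracket {K : Type*} [Field K] {g : Type*} [LieRing g] [LieAlgebra K g]
    {n : ℕ} {E : ℕ → g} (hV : IsVnBasis K n E) (i j : ℕ) (hi : 1 ≤ i) (hj : 1 ≤ j) :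
    ⁅E i, E j⁆ = ((j : K) - (i : K)) • E (i + j) := by
  obtain ⟨-, h0, hb⟩ := hV
  by_cases hin : n < i
  · rw [h0 i (Or.inr hin), h0 (i + j) (Or.inr (by omega))]; simp
  by_cases hjn : n < j
  · rw [h0 j (Or.inr hjn), h0 (i + j) (Or.inr (by omega))]; simp
  rcases lt_trichotomy i j with h | h | h
  · exact hb i j hi h (by omega)
  · subst h; simp
  · rw [← lie_skew, hb j i hj h (by omega), add_comm j i, ← neg_smul, neg_sub]

theorem Vn_mem {K : Type*} [Field K] {g : Type*} [LieRing g] [LieAlgebra K g]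
    {n : ℕ} {E : ℕ → g} (hV : IsVnBasis K n E) (m i : ℕ) (hi : m ≤ i) :
    E i ∈ Submodule.span K (E '' Set.Icc m n) := by
  by_cases hin : n < i
  · rw [hV.2.1 i (Or.inr hin)]; exact Submodule.zero_mem _
  · exact Submodule.subset_span ⟨i, ⟨hi, by omega⟩, rfl⟩

theorem Vn_top {K : Type*} [Field K] {g : Type*} [LieRing g] [LieAlgebra K g]
    {n : ℕ} {E : ℕ → g} (hV : IsVnBasis K n E) :
    Submodule.span K (E '' Set.Icc 1 n) = ⊤ := by
  obtain ⟨b, hb⟩ := hV.1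
  rw [eq_top_iff, ← b.span_eq, Submodule.span_le]
  rintro _ ⟨i, rfl⟩
  rw [← hb i]
  exact Vn_mem hV 1 _ (by omega)

theorem Vn_lie_mem {K : Type*} [Field K] {g : Type*} [LieRing g] [LieAlgebra K g]
    {n : ℕ} {E : ℕ → g} (hV : IsVnBasis K n E) (m m' : ℕ) (hm : 1 ≤ m)
    (hmm : ∀ i j : ℕ, 1 ≤ i → m ≤ j → i = j ∨ m' ≤ i + j) (x y : g)
    (hy : y ∈ Submodule.span K (E '' Set.Icc m n)) :
    ⁅x, y⁆ ∈ Submodule.span K (E '' Set.Icc m' n) := by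
  have hx : x ∈ Submodule.span K (E '' Set.Icc 1 n) := by rw [Vn_top hV]; trivial
  induction hx using Submodule.span_induction with
  | zero => simp
  | add a b _ _ ha hb => rw [add_lie]; exact Submodule.add_mem _ ha hb
  | smul c a _ ha => rw [smul_lie]; exact Submodule.smul_mem _ _ ha
  | mem a ha =>
    obtain ⟨i, hi, rfl⟩ := ha
    induction hy using Submodule.span_induction with
    | zero => simp
    | add a b _ _ ha hb => rw [lie_add]; exact Submodule.add_mem _ ha hb
    | smul c a _ ha => rw [lie_smul]; exact Submodule.smul_mem _ _ ha
    | mem b hb =>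
      obtain ⟨j, hj, rfl⟩ := hb
      rcases hmm i j hi.1 hj.1 with h | h
      · subst h; simp
      · rw [Vn_bracket hV i j hi.1 (hm.trans hj.1)]
        exact Submodule.smul_mem _ _ (Vn_mem hV _ _ h)

theorem Vn_lcs {K : Type*} [Field K] [CharZero K] {g : Type*} [LieRing g] [LieAlgebra K g]
    {n : ℕ} {E : ℕ → g} (hV : IsVnBasis K n E) (k : ℕ) :
    lcs K g (k + 1) = Submodule.span K (E '' Set.Icc (k + 3) n) := by
  have key : ∀ k : ℕ, (∀ i, k + 2 ≤ i → E i ∈ lcs K g k) →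
      Submodule.span K (E '' Set.Icc (k + 3) n) ≤ lcs K g (k + 1) := by
    intro k hk
    rw [Submodule.span_le]
    rintro _ ⟨i, hi, rfl⟩
    obtain ⟨j, rfl⟩ : ∃ j, i = 1 + (j + 2) := ⟨i - 3, by have := hi.1; omega⟩
    have h := Vn_bracket hV 1 (j + 2) le_rfl (by omega)
    have hc : (((j + 2 : ℕ) : K) - ((1 : ℕ) : K)) ≠ 0 := by
      rw [sub_ne_zero]; exact_mod_cast (by omega : j + 2 ≠ 1)
    have h2 : E (1 + (j + 2)) = (((j + 2 : ℕ) : K) - ((1 : ℕ) : K))⁻¹ • ⁅E 1, E (j + 2)⁆ := by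
      rw [h, smul_smul, inv_mul_cancel₀ hc, one_smul]
    rw [h2]
    refine Submodule.smul_mem _ _ (Submodule.subset_span ⟨_, _, hk _ ?_, rfl⟩)
    have := hi.1
    omega
  induction k with
  | zero =>
    refine le_antisymm ?_ (key 0 fun i _ => Submodule.mem_top)
    refine Submodule.span_le.2 ?_
    rintro _ ⟨x, y, -, rfl⟩
    exact Vn_lie_mem hV 1 3 le_rfl (by omega) x y (by rw [Vn_top hV]; trivial)
  | succ k ih =>
    refine le_antisymm ?_ (key (k + 1) fun i hi => by rw [ih]; exact Vn_mem hV _ _ hi)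
    refine Submodule.span_le.2 ?_
    rintro _ ⟨x, y, hy, rfl⟩
    rw [ih] at hy
    exact Vn_lie_mem hV (k + 3) (k + 1 + 3) (by omega) (by omega) x y hy

/-- for `n ≥ 3`, the lower central series of `V_n` is
`C^k V_n = span(e_{k+1}, …, e_n)` for `2 ≤ k ≤ n`; in particular `C^n V_n = 0` and
`C^{n-1} V_n = span(e_n) ≠ 0`, so `V_n` is filiform. -/
theorem statement17 {K : Type*} [Field K] [CharZero K]
    {g : Type*} [LieRing g] [LieAlgebra K g]
    (n : ℕ) (hn : 3 ≤ n) (E : ℕ → g) (hV : IsVnBasis K n E) :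
    (∀ k : ℕ, 2 ≤ k → k ≤ n →
      lcs K g (k - 1) = Submodule.span K (E '' Set.Icc (k + 1) n)) ∧
    lcs K g (n - 1) = ⊥ ∧
    lcs K g (n - 2) = Submodule.span K {E n} ∧
    lcs K g (n - 2) ≠ ⊥ := by
  obtain ⟨m, rfl⟩ : ∃ m, n = m + 3 := ⟨n - 3, by omega⟩
  have h2 : lcs K g (m + 3 - 2) = Submodule.span K {E (m + 3)} := by
    have h := Vn_lcs hV m
    rw [Set.Icc_self, Set.image_singleton] at h
    exact h
  refine ⟨?_, ?_, h2, ?_⟩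
  · intro k hk _
    obtain ⟨l, rfl⟩ : ∃ l, k = l + 2 := ⟨k - 2, by omega⟩
    exact Vn_lcs hV l
  · have h := Vn_lcs hV (m + 1)
    rw [Set.Icc_eq_empty (by omega), Set.image_empty, Submodule.span_empty] at h
    exact h
  · rw [h2, Ne, Submodule.span_singleton_eq_bot]
    obtain ⟨b, hb⟩ := hV.1
    have h := hb ⟨m + 2, by omega⟩
    intro h0
    exact b.ne_zero ⟨m + 2, by omega⟩ (h.symm.trans h0)

end Paper
end
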